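/- Let w ∈ A_1, 0 < β ≤ 1 and 1 < q < 2. Then for every j ∈ ℕ and f ∈ L^1_loc(ℝ^n), ‖S_{β,2^j}(f)‖_{L^q_w} ≤ C 2^{jn/q} ‖S_β(f)‖_{L^q_w}, with C independent of j and f. -/

import Mathlib

open MeasureTheory Metric Set

noncomputable section

/-- `ℝⁿ` as a Euclidean space. -/
abbrev Rn (n : ℕ) : Type := EuclideanSpace ℝ (Fin n)

variable {n : ℕ}

/-- Weighted measure of a set: `w(E) = ∫_E w`. -/
def wMeas (w : Rn n → ℝ) (s : Set (Rn n)) : ℝ := ∫ x in s, w x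

/-- The Muckenhoupt `A₁` condition with constant `C`. -/
def IsA1 (w : Rn n → ℝ) (C : ℝ) : Prop :=
  (∀ x, 0 ≤ w x) ∧ MeasureTheory.LocallyIntegrable w ∧
    ∀ (x₀ : Rn n) (R : ℝ), 0 < R →
      (∫ x in ball x₀ R, w x) ≤
        C * (volume (ball x₀ R)).toReal * essInf w (volume.restrict (ball x₀ R))

/-- The Muckenhoupt `A_p` condition (`1 < p`) with constant `C`. -/
def IsAp (w : Rn n → ℝ) (p C : ℝ) : Prop :=
  (∀ x, 0 ≤ w x) ∧ MeasureTheory.LocallyIntegrable w ∧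
    ∀ (x₀ : Rn n) (R : ℝ), 0 < R →
      ((volume (ball x₀ R)).toReal⁻¹ * ∫ x in ball x₀ R, w x) *
        ((volume (ball x₀ R)).toReal⁻¹ * ∫ x in ball x₀ R, (w x) ^ (-(1 / (p - 1)))) ^ (p - 1)
        ≤ C

/-- The reverse Hölder condition `RH_r` with constant `C`. -/
def IsRH (w : Rn n → ℝ) (r C : ℝ) : Prop :=
  ∀ (x₀ : Rn n) (R : ℝ), 0 < R →
    ((volume (ball x₀ R)).toReal⁻¹ * ∫ x in ball x₀ R, (w x) ^ r) ^ (1 / r) ≤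
      C * ((volume (ball x₀ R)).toReal⁻¹ * ∫ x in ball x₀ R, w x)

/-- The class `C_β`: support in the closed unit ball, mean zero, β-Hölder with constant 1. -/
def MemCbeta (β : ℝ) (φ : Rn n → ℝ) : Prop :=
  (∀ x, φ x ≠ 0 → ‖x‖ ≤ 1) ∧ MeasureTheory.Integrable φ ∧ (∫ x, φ x) = 0 ∧
    ∀ x x' : Rn n, |φ x - φ x'| ≤ ‖x - x'‖ ^ β

/-- Convolution `f * φ_t (x)` with the dilation `φ_t(x) = t^{-n} φ(x/t)`. -/
def convPhi (f φ : Rn n → ℝ) (t : ℝ) (x : Rn n) : ℝ :=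
  ∫ y, f y * (t ^ (-(n : ℝ)) * φ (t⁻¹ • (x - y)))

/-- The intrinsic averaging function `A_β(f)(y,t) = sup_{φ ∈ C_β} |f * φ_t(y)|`. -/
def Abeta (β : ℝ) (f : Rn n → ℝ) (y : Rn n) (t : ℝ) : ℝ :=
  ⨆ φ : {φ : Rn n → ℝ // MemCbeta β φ}, |convPhi f φ.1 t y|

/-- The intrinsic Littlewood–Paley `g`-function. -/
def gbeta (β : ℝ) (f : Rn n → ℝ) (x : Rn n) : ℝ :=
  (∫ t in Ioi (0 : ℝ), (Abeta β f x t) ^ 2 / t) ^ (1 / 2 : ℝ)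

/-- The intrinsic Lusin area function of aperture `γ`. -/
def SbetaA (β γ : ℝ) (f : Rn n → ℝ) (x : Rn n) : ℝ :=
  (∫ p in {p : Rn n × ℝ | dist x p.1 < γ * p.2 ∧ 0 < p.2},
      (Abeta β f p.1 p.2) ^ 2 / p.2 ^ (n + 1)) ^ (1 / 2 : ℝ)

/-- The intrinsic `g^*_λ` function. -/
def gstar (lam β : ℝ) (f : Rn n → ℝ) (x : Rn n) : ℝ :=
  (∫ p in {p : Rn n × ℝ | 0 < p.2},
      (p.2 / (p.2 + dist x p.1)) ^ (lam * (n : ℝ)) * (Abeta β f p.1 p.2) ^ 2 / p.2 ^ (n + 1)) ^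
    (1 / 2 : ℝ)

/-- The weighted `L^q` norm `(∫ |g|^q w)^{1/q}`. -/
def wLq (q : ℝ) (w g : Rn n → ℝ) : ℝ := (∫ x, |g x| ^ q * w x) ^ (1 / q)

/-- The weighted Hardy–Littlewood maximal operator. -/
def Mw (w b : Rn n → ℝ) (x : Rn n) : ℝ :=
  ⨆ B : {B : Rn n × ℝ // 0 < B.2 ∧ x ∈ ball B.1 B.2},
    (wMeas w (ball B.1.1 B.1.2))⁻¹ * ∫ y in ball B.1.1 B.1.2, |b y| * w y

/-- A central `(α, q, 0; w₁, w₂)`-atom supported in `B(0,R)`. -/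
def IsCentralAtom (α q R : ℝ) (w₁ w₂ a : Rn n → ℝ) : Prop :=
  MeasureTheory.Integrable a ∧ (∀ x, a x ≠ 0 → x ∈ ball (0 : Rn n) R) ∧
    wLq q w₂ a ≤ (wMeas w₁ (ball (0 : Rn n) R)) ^ (-(α / (n : ℝ))) ∧
    (∫ x, a x) = 0

/-- The homogeneous weighted Herz norm `‖f‖_{\dot K^{α,p}_q(w₁,w₂)}`. -/
def herzNorm (α p q : ℝ) (w₁ w₂ f : Rn n → ℝ) : ℝ :=
  (∑' k : ℤ,
      (wMeas w₁ (closedBall (0 : Rn n) ((2 : ℝ) ^ k))) ^ (α * p / (n : ℝ)) *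
        ((∫ x in closedBall (0 : Rn n) ((2 : ℝ) ^ k) \ closedBall (0 : Rn n) ((2 : ℝ) ^ (k - 1)),
            |f x| ^ q * w₂ x) ^ (1 / q)) ^ p) ^ (1 / p)

/-! ### Dilated kernels -/

/-- The kernel `z ↦ φ_t(y - z)`. -/
def dilKernel (φ : Rn n → ℝ) (t : ℝ) (y z : Rn n) : ℝ :=
  t ^ (-(n : ℝ)) * φ (t⁻¹ • (y - z))

/-- A mean-zero bump centred at `y`, at scale `t`, with Hölder exponent `β`. -/
structure IsBump (β : ℝ) (ψ : Rn n → ℝ) (y : Rn n) (t : ℝ) : Prop where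
  support : ∀ z, ψ z ≠ 0 → dist z y ≤ t
  bound : ∀ z, |ψ z| ≤ 3 * (t ^ n)⁻¹
  holder : ∀ z z', |ψ z - ψ z'| ≤ (t ^ n)⁻¹ * (dist z z' / t) ^ β
  mean : ∫ z, ψ z = 0

lemma continuous_of_abs_sub_le {β C : ℝ} (hβ : 0 < β) {φ : Rn n → ℝ}
    (h : ∀ x x', |φ x - φ x'| ≤ C * dist x x' ^ β) : Continuous φ := by
  rw [continuous_iff_continuousAt]
  intro x
  rw [ContinuousAt, tendsto_iff_dist_tendsto_zero]
  refine squeeze_zero (fun _ => dist_nonneg) (fun z => h z x) ?_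
  have h1 : Continuous fun z : Rn n => C * dist z x ^ β :=
    continuous_const.mul ((continuous_id.dist continuous_const).rpow_const
      fun _ => Or.inr hβ.le)
  have := h1.tendsto x
  simpa [Real.zero_rpow hβ.ne'] using this

lemma MemCbeta.continuous {β : ℝ} (hβ : 0 < β) {φ : Rn n → ℝ} (h : MemCbeta β φ) :
    Continuous φ :=
  continuous_of_abs_sub_le (C := 1) hβ fun x x' => by
    rw [one_mul, dist_eq_norm]; exact h.2.2.2 x x'

lemma MemCbeta.abs_le {β : ℝ} (hβ : 0 < β) (hβ1 : β ≤ 1) {φ : Rn n → ℝ} (h : MemCbeta β φ)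
    (x : Rn n) : |φ x| ≤ 3 := by
  by_cases hx : φ x = 0
  · simp [hx]
  have hx1 := h.1 x hx
  rcases Nat.eq_zero_or_pos n with rfl | hn
  · have h0 : ∫ y, φ y = 0 := h.2.2.1
    have : φ = fun _ => φ x := funext fun y => by rw [Subsingleton.elim y x]
    rw [this] at h0
    have hv : (volume : Measure (Rn 0)).real univ ≠ 0 := by
      rw [Measure.real, ENNReal.toReal_ne_zero]
      refine ⟨by simp [NeZero.ne], ?_⟩
      exact (isCompact_univ : IsCompact (univ : Set (Rn 0))).measure_lt_top.ne
    simp only [integral_const, smul_eq_mul, mul_eq_zero] at h0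
    exact absurd (h0.resolve_left hv) hx
  · have : Nonempty (Fin n) := ⟨⟨0, hn⟩⟩
    obtain ⟨e, he⟩ := exists_norm_eq (Rn n) (zero_le_two (α := ℝ))
    have he0 : φ e = 0 := by
      by_contra hne
      have := h.1 e hne
      linarith
    have h1 := h.2.2.2 x e
    rw [he0, sub_zero] at h1
    have h2 : ‖x - e‖ ≤ 3 := (norm_sub_le _ _).trans (by linarith)
    calc |φ x| ≤ ‖x - e‖ ^ β := h1
      _ ≤ 3 ^ β := Real.rpow_le_rpow (norm_nonneg _) h2 hβ.le
      _ ≤ 3 ^ (1 : ℝ) := Real.rpow_le_rpow_of_exponent_le (by norm_num) hβ1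
      _ = 3 := Real.rpow_one 3

lemma MemCbeta.isBump {β : ℝ} (hβ : 0 < β) (hβ1 : β ≤ 1) {φ : Rn n → ℝ} (h : MemCbeta β φ)
    {t : ℝ} (ht : 0 < t) (y : Rn n) : IsBump β (dilKernel φ t y) y t := by
  have htn : t ^ (-(n : ℝ)) = (t ^ n)⁻¹ := by rw [Real.rpow_neg ht.le, Real.rpow_natCast]
  have hpos : 0 < (t ^ n)⁻¹ := by positivity
  refine ⟨fun z hz => ?_, fun z => ?_, fun z z' => ?_, ?_⟩
  · have h1 : φ (t⁻¹ • (y - z)) ≠ 0 := right_ne_zero_of_mul hz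
    have h2 := h.1 _ h1
    rw [norm_smul, norm_inv, Real.norm_of_nonneg ht.le, inv_mul_le_iff₀ ht, mul_one] at h2
    rwa [dist_comm, dist_eq_norm]
  · rw [dilKernel, htn, abs_mul, abs_of_pos hpos, mul_comm]
    gcongr
    exact h.abs_le hβ hβ1 _
  · rw [dilKernel, dilKernel, htn, ← mul_sub, abs_mul, abs_of_pos hpos]
    gcongr
    refine (h.2.2.2 _ _).trans (le_of_eq ?_)
    rw [← smul_sub, norm_smul, norm_inv, Real.norm_of_nonneg ht.le, sub_sub_sub_cancel_left,
      dist_comm, dist_eq_norm, inv_mul_eq_div]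
  · simp only [dilKernel]
    rw [integral_const_mul]
    have h1 := integral_sub_left_eq_self (μ := (volume : Measure (Rn n)))
      (fun z => φ (t⁻¹ • z)) y
    rw [h1, Measure.integral_comp_smul, h.2.2.1]
    simp

namespace IsBump

variable {β : ℝ} {ψ : Rn n → ℝ} {y : Rn n} {t : ℝ}

lemma continuous (h : IsBump β ψ y t) (hβ : 0 < β) (ht : 0 < t) : Continuous ψ := by
  refine continuous_of_abs_sub_le (C := (t ^ n)⁻¹ * (t ^ β)⁻¹) hβ fun x x' => ?_
  refine (h.holder x x').trans (le_of_eq ?_)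
  rw [Real.div_rpow dist_nonneg ht.le]
  ring

lemma hasCompactSupport (h : IsBump β ψ y t) : HasCompactSupport ψ :=
  HasCompactSupport.intro (isCompact_closedBall y t) fun z hz => by
    by_contra hne
    exact hz (mem_closedBall.2 (h.support z hne))

lemma integrable (h : IsBump β ψ y t) (hβ : 0 < β) (ht : 0 < t) : Integrable ψ :=
  (h.continuous hβ ht).integrable_of_hasCompactSupport h.hasCompactSupport

lemma abs_le_indicator (h : IsBump β ψ y t) (z : Rn n) :
    |ψ z| ≤ (closedBall y t).indicator (fun _ => 3 * (t ^ n)⁻¹) z := by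
  by_cases hz : z ∈ closedBall y t
  · rw [indicator_of_mem hz]; exact h.bound z
  · rw [indicator_of_notMem hz]
    by_contra hne
    exact hz (mem_closedBall.2 (h.support z fun h0 => hne (by simp [h0])))

lemma integral_abs_le (h : IsBump β ψ y t) (hβ : 0 < β) (ht : 0 < t) :
    ∫ z, |ψ z| ≤ 3 * volume.real (ball (0 : Rn n) 1) := by
  have h1 : ∫ z, |ψ z| ≤ ∫ z, (closedBall y t).indicator (fun _ => 3 * (t ^ n)⁻¹) z := by
    refine integral_mono (h.integrable hβ ht).abs ?_ h.abs_le_indicator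
    exact (integrable_indicator_iff measurableSet_closedBall).2
      (integrableOn_const (isCompact_closedBall y t).measure_lt_top.ne)
  refine h1.trans (le_of_eq ?_)
  rw [integral_indicator measurableSet_closedBall, setIntegral_const,
    Measure.addHaar_real_closedBall _ _ ht.le, finrank_euclideanSpace, Fintype.card_fin,
    smul_eq_mul]
  field_simp

lemma integrable_mul (h : IsBump β ψ y t) (hβ : 0 < β) (ht : 0 < t) {f : Rn n → ℝ}
    (hf : LocallyIntegrable f) : Integrable fun z => f z * ψ z := by
  have := hf.integrable_smul_right_of_hasCompactSupport (h.continuous hβ ht) h.hasCompactSupport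
  simpa [smul_eq_mul] using this

lemma abs_integral_mul_le (h : IsBump β ψ y t) (hβ : 0 < β) (ht : 0 < t) {f : Rn n → ℝ}
    (hf : LocallyIntegrable f) :
    |∫ z, f z * ψ z| ≤ 3 * (t ^ n)⁻¹ * ∫ z in closedBall y t, |f z| := by
  have hfi : IntegrableOn f (closedBall y t) := hf.integrableOn_isCompact (isCompact_closedBall y t)
  calc |∫ z, f z * ψ z| ≤ ∫ z, |f z * ψ z| := abs_integral_le_integral_abs
    _ ≤ ∫ z, (closedBall y t).indicator (fun z => 3 * (t ^ n)⁻¹ * |f z|) z := by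
        refine integral_mono (h.integrable_mul hβ ht hf).abs
          ((integrable_indicator_iff measurableSet_closedBall).2 (hfi.abs.const_mul _)) fun z => ?_
        have := h.abs_le_indicator z
        by_cases hz : z ∈ closedBall y t
        · simp only [indicator_of_mem hz] at this ⊢
          rw [abs_mul, mul_comm]
          gcongr
        · simp only [indicator_of_notMem hz] at this ⊢
          rw [abs_mul, abs_nonpos_iff.1 this]
          simp
    _ = _ := by
        rw [integral_indicator measurableSet_closedBall, integral_const_mul]

/-- Almost orthogonality of two bumps. -/
lemma abs_integral_mul_bump_le (h : IsBump β ψ y t) (hβ : 0 < β) (ht : 0 < t)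
    {ψ' : Rn n → ℝ} {y' : Rn n} {t' : ℝ} (h' : IsBump β ψ' y' t') (ht' : 0 < t') :
    |∫ z, ψ z * ψ' z| ≤ 3 * volume.real (ball (0 : Rn n) 1) * ((t ^ n)⁻¹ * (t' / t) ^ β) := by
  have hi := h.integrable_mul hβ ht (h'.continuous hβ ht').locallyIntegrable
  have e1 : ∫ z, ψ z * ψ' z = ∫ z, (ψ z - ψ y') * ψ' z := by
    simp only [sub_mul]
    rw [integral_sub (by simpa [mul_comm] using hi) ((h'.integrable hβ ht').const_mul _),
      integral_const_mul, h'.mean, mul_zero, sub_zero]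
  rw [e1]
  calc |∫ z, (ψ z - ψ y') * ψ' z| ≤ ∫ z, |(ψ z - ψ y') * ψ' z| := abs_integral_le_integral_abs
    _ ≤ ∫ z, ((t ^ n)⁻¹ * (t' / t) ^ β) * |ψ' z| := by
        refine integral_mono_of_nonneg (Filter.Eventually.of_forall fun _ => abs_nonneg _)
          ((h'.integrable hβ ht').abs.const_mul _) (Filter.Eventually.of_forall fun z => ?_)
        simp only [abs_mul]
        by_cases hz : ψ' z = 0
        · simp [hz]
        · gcongr
          refine (h.holder z y').trans ?_
          gcongr
          exact h'.support z hz
    _ = ((t ^ n)⁻¹ * (t' / t) ^ β) * ∫ z, |ψ' z| := integral_const_mul _ _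
    _ ≤ ((t ^ n)⁻¹ * (t' / t) ^ β) * (3 * volume.real (ball (0 : Rn n) 1)) := by
        gcongr
        exact h'.integral_abs_le hβ ht'
    _ = _ := by ring

/-- Bumps with disjoint supports are orthogonal. -/
lemma integral_mul_bump_eq_zero (h : IsBump β ψ y t) {ψ' : Rn n → ℝ} {y' : Rn n} {t' : ℝ}
    (h' : IsBump β ψ' y' t') (hd : t + t' < dist y y') : ∫ z, ψ z * ψ' z = 0 := by
  have : ∀ z, ψ z * ψ' z = 0 := fun z => by
    by_contra hne
    have h1 := h.support z (left_ne_zero_of_mul hne)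
    have h2 := h'.support z (right_ne_zero_of_mul hne)
    have h3 := dist_triangle_left y y' z
    linarith
  simp [this]

end IsBump

/-! ### The intrinsic averaging function -/

lemma memCbeta_zero {β : ℝ} : MemCbeta β (fun _ : Rn n => (0 : ℝ)) :=
  ⟨fun _ h => absurd rfl h, integrable_zero _ _ _, by simp, fun x x' => by
    simp only [sub_zero, abs_zero]
    positivity⟩

lemma MemCbeta.neg {β : ℝ} {φ : Rn n → ℝ} (h : MemCbeta β φ) : MemCbeta β (fun x => -φ x) :=
  ⟨fun x hx => h.1 x fun h0 => hx (by simp [h0]), h.2.1.neg, by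
    rw [integral_neg, h.2.2.1, neg_zero], fun x x' => by
    rw [neg_sub_neg, abs_sub_comm]
    exact h.2.2.2 x x'⟩

instance {β : ℝ} : Nonempty {φ : Rn n → ℝ // MemCbeta β φ} := ⟨⟨_, memCbeta_zero⟩⟩

lemma convPhi_eq (f φ : Rn n → ℝ) (t : ℝ) (y : Rn n) :
    convPhi f φ t y = ∫ z, f z * dilKernel φ t y z := rfl

section Abeta

variable {β : ℝ} {f : Rn n → ℝ} {t : ℝ}

lemma bddAbove_convPhi (hβ : 0 < β) (hβ1 : β ≤ 1) (hf : LocallyIntegrable f) (ht : 0 < t)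
    (y : Rn n) :
    BddAbove (range fun φ : {φ : Rn n → ℝ // MemCbeta β φ} => |convPhi f φ.1 t y|) := by
  refine ⟨3 * (t ^ n)⁻¹ * ∫ z in closedBall y t, |f z|, ?_⟩
  rintro _ ⟨φ, rfl⟩
  exact (φ.2.isBump hβ hβ1 ht y).abs_integral_mul_le hβ ht hf

lemma abs_convPhi_le_Abeta (hβ : 0 < β) (hβ1 : β ≤ 1) (hf : LocallyIntegrable f) (ht : 0 < t)
    (y : Rn n) {φ : Rn n → ℝ} (hφ : MemCbeta β φ) : |convPhi f φ t y| ≤ Abeta β f y t :=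
  le_ciSup (bddAbove_convPhi hβ hβ1 hf ht y) (⟨φ, hφ⟩ : {φ : Rn n → ℝ // MemCbeta β φ})

lemma Abeta_nonneg (y : Rn n) (t : ℝ) : 0 ≤ Abeta β f y t :=
  Real.iSup_nonneg fun _ => abs_nonneg _

lemma Abeta_le (hβ : 0 < β) (hβ1 : β ≤ 1) (hf : LocallyIntegrable f) (ht : 0 < t) (y : Rn n) :
    Abeta β f y t ≤ 3 * (t ^ n)⁻¹ * ∫ z in closedBall y t, |f z| :=
  ciSup_le fun φ => (φ.2.isBump hβ hβ1 ht y).abs_integral_mul_le hβ ht hf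

lemma exists_Abeta_le_two_mul (y : Rn n) (t : ℝ) :
    ∃ φ : Rn n → ℝ, MemCbeta β φ ∧ Abeta β f y t ≤ 2 * convPhi f φ t y := by
  rcases (Abeta_nonneg (β := β) (f := f) y t).eq_or_lt with h0 | h0
  · exact ⟨_, memCbeta_zero, by rw [← h0]; simp [convPhi]⟩
  · obtain ⟨φ, hφ⟩ := exists_lt_of_lt_ciSup (half_lt_self h0)
    change Abeta β f y t / 2 < _ at hφ
    rcases le_total 0 (convPhi f φ.1 t y) with hs | hs
    · rw [abs_of_nonneg hs] at hφ
      exact ⟨φ.1, φ.2, by linarith⟩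
    · rw [abs_of_nonpos hs] at hφ
      refine ⟨_, φ.2.neg, ?_⟩
      have : convPhi f (fun x => -φ.1 x) t y = -convPhi f φ.1 t y := by
        simp [convPhi, integral_neg]
      rw [this]
      linarith

/-- Comparison of the intrinsic averages at different points and scales. -/
lemma Abeta_le_mul_Abeta (hβ : 0 < β) (hβ1 : β ≤ 1) (hf : LocallyIntegrable f) (ht : 0 < t)
    {t' : ℝ} {y y' : Rn n} (h : dist y y' + t ≤ t') :
    Abeta β f y t ≤ (t' / t) ^ n * (t' / t) ^ β * Abeta β f y' t' := by
  have ht' : 0 < t' := by linarith [dist_nonneg (x := y) (y := y')]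
  refine ciSup_le fun φ => ?_
  obtain ⟨φ, hφ⟩ := φ
  set K : ℝ := (t' / t) ^ n * (t' / t) ^ β with hK
  have hKpos : 0 < K := by positivity
  set ψ : Rn n → ℝ := fun u => K⁻¹ * (t' / t) ^ n * φ (t⁻¹ • (y - y' + t' • u)) with hψ
  have hψm : MemCbeta β ψ := by
    have hcont : Continuous ψ := continuous_const.mul
      ((hφ.continuous hβ).comp (by fun_prop))
    have hsupp : ∀ x, ψ x ≠ 0 → ‖x‖ ≤ 1 := fun x hx => by
      have h1 := hφ.1 _ (right_ne_zero_of_mul hx)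
      rw [norm_smul, norm_inv, Real.norm_of_nonneg ht.le, inv_mul_le_iff₀ ht, mul_one] at h1
      have h2 : ‖t' • x‖ ≤ t' := by
        calc ‖t' • x‖ = ‖(y - y' + t' • x) - (y - y')‖ := by rw [add_sub_cancel_left]
          _ ≤ ‖y - y' + t' • x‖ + ‖y - y'‖ := norm_sub_le _ _
          _ ≤ t' := by rw [← dist_eq_norm y y']; linarith
      rw [norm_smul, Real.norm_of_nonneg ht'.le] at h2
      nlinarith
    refine ⟨hsupp, ?_, ?_, fun x x' => ?_⟩
    · refine hcont.integrable_of_hasCompactSupport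
        (HasCompactSupport.intro (isCompact_closedBall 0 1) fun z hz => ?_)
      by_contra hne
      exact hz (mem_closedBall_zero_iff.2 (hsupp z hne))
    · rw [hψ, integral_const_mul]
      have h1 : ∫ u : Rn n, φ (t⁻¹ • (y - y' + t' • u)) = 0 := by
        rw [Measure.integral_comp_smul volume (fun u => φ (t⁻¹ • (y - y' + u))) t',
          integral_add_left_eq_self (fun u => φ (t⁻¹ • u)) (y - y'),
          Measure.integral_comp_smul, hφ.2.2.1]
        simp
      rw [h1, mul_zero]
    · rw [hψ]
      simp only
      rw [← mul_sub, abs_mul, abs_of_nonneg (by positivity)]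
      have h1 := hφ.2.2.2 (t⁻¹ • (y - y' + t' • x)) (t⁻¹ • (y - y' + t' • x'))
      have h2 : ‖t⁻¹ • (y - y' + t' • x) - t⁻¹ • (y - y' + t' • x')‖ = t' / t * ‖x - x'‖ := by
        rw [← smul_sub, add_sub_add_left_eq_sub, ← smul_sub, smul_smul, norm_smul,
          Real.norm_of_nonneg (by positivity), div_eq_inv_mul]
      rw [h2, Real.mul_rpow (by positivity) (norm_nonneg _)] at h1
      calc _ ≤ K⁻¹ * (t' / t) ^ n * ((t' / t) ^ β * ‖x - x'‖ ^ β) := by gcongr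
        _ = K⁻¹ * K * ‖x - x'‖ ^ β := by rw [hK]; ring
        _ = _ := by rw [inv_mul_cancel₀ hKpos.ne', one_mul]
  have key : convPhi f φ t y = K * convPhi f ψ t' y' := by
    rw [convPhi, convPhi, ← integral_const_mul]
    congr 1
    ext z
    have h1 : t' • (t'⁻¹ • (y' - z)) = y' - z := smul_inv_smul₀ ht'.ne' _
    rw [hψ]
    simp only [h1, sub_add_sub_cancel, Real.rpow_neg ht.le, Real.rpow_neg ht'.le,
      Real.rpow_natCast, div_pow]
    field_simp
  rw [key, abs_mul, abs_of_pos hKpos]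
  gcongr
  exact abs_convPhi_le_Abeta hβ hβ1 hf ht' y' hψm

/-- `A_β(f)(y,t)` only depends on `f` in the closed ball of radius `t` around `y`. -/
lemma Abeta_congr (hβ : 0 < β) (hβ1 : β ≤ 1) (ht : 0 < t) {y : Rn n} {g : Rn n → ℝ}
    (h : ∀ z ∈ closedBall y t, f z = g z) : Abeta β f y t = Abeta β g y t := by
  refine iSup_congr fun φ => ?_
  rw [convPhi_eq, convPhi_eq]
  congr 2
  ext z
  by_cases hz : dilKernel φ.1 t y z = 0
  · rw [hz, mul_zero, mul_zero]
  · rw [h z (mem_closedBall.2 ((φ.2.isBump hβ hβ1 ht y).support z hz))]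

lemma continuousAt_convPhi (hβ : 0 < β) (hβ1 : β ≤ 1) (hf : LocallyIntegrable f)
    {φ : Rn n → ℝ} (hφ : MemCbeta β φ) (p : Rn n × ℝ) (hp : 0 < p.2) :
    ContinuousAt (fun p : Rn n × ℝ => convPhi f φ p.2 p.1) p := by
  obtain ⟨y, t⟩ := p
  simp only at hp
  set B := closedBall y (1 + 2 * t)
  have hfi : IntegrableOn f B := hf.integrableOn_isCompact (isCompact_closedBall _ _)
  have hU : ∀ᶠ q : Rn n × ℝ in nhds (y, t), q.1 ∈ ball y 1 ∧ q.2 ∈ Ioo (t / 2) (2 * t) := by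
    rw [nhds_prod_eq]
    exact Filter.Eventually.prod_mk (ball_mem_nhds y one_pos)
      (Ioo_mem_nhds (by linarith) (by linarith))
  refine continuousAt_of_dominated
    (bound := B.indicator fun z => 3 * ((t / 2) ^ n)⁻¹ * |f z|) ?_ ?_ ?_ ?_
  · filter_upwards [hU] with q hq
    have hq2 : 0 < q.2 := by linarith [hq.2.1]
    exact ((hφ.isBump hβ hβ1 hq2 q.1).integrable_mul hβ hq2 hf).aestronglyMeasurable
  · filter_upwards [hU] with q hq
    have hq2 : 0 < q.2 := by linarith [hq.2.1]
    have hb := hφ.isBump hβ hβ1 hq2 q.1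
    refine Filter.Eventually.of_forall fun z => ?_
    change ‖f z * dilKernel φ q.2 q.1 z‖ ≤ _
    by_cases hz : dilKernel φ q.2 q.1 z = 0
    · rw [hz, mul_zero, norm_zero]
      exact indicator_nonneg (fun _ _ => by positivity) _
    · have h1 := hb.support z hz
      have hzB : z ∈ B := by
        have := dist_triangle z q.1 y
        have h2 := mem_ball.1 hq.1
        exact mem_closedBall.2 (by linarith [hq.2.2])
      rw [indicator_of_mem hzB, norm_mul, Real.norm_eq_abs, Real.norm_eq_abs, mul_comm]
      gcongr
      refine (hb.bound z).trans ?_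
      gcongr
      exact hq.2.1.le
  · exact (integrable_indicator_iff measurableSet_closedBall).2 (hfi.abs.const_mul _)
  · refine Filter.Eventually.of_forall fun z => ?_
    refine continuousAt_const.mul (ContinuousAt.mul ?_ ?_)
    · exact continuousAt_snd.rpow_const (Or.inl hp.ne')
    · refine (hφ.continuous hβ).continuousAt.comp ?_
      exact (continuousAt_snd.inv₀ hp.ne').smul (continuousAt_fst.sub continuousAt_const)

/-- The density `A_β(f)(y,t)² t^{-n-1}` on the upper half space, as an extended nonnegative
function. -/
def areaDensity (β : ℝ) (f : Rn n → ℝ) (p : Rn n × ℝ) : ENNReal :=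
  {p : Rn n × ℝ | 0 < p.2}.indicator
    (fun p => ENNReal.ofReal (Abeta β f p.1 p.2 ^ 2 / p.2 ^ (n + 1))) p

lemma areaDensity_of_pos {p : Rn n × ℝ} (hp : 0 < p.2) :
    areaDensity β f p = ENNReal.ofReal (Abeta β f p.1 p.2 ^ 2 / p.2 ^ (n + 1)) :=
  indicator_of_mem (s := {p : Rn n × ℝ | 0 < p.2}) hp _

lemma areaDensity_of_not_pos {p : Rn n × ℝ} (hp : ¬ 0 < p.2) : areaDensity β f p = 0 :=
  indicator_of_notMem (s := {p : Rn n × ℝ | 0 < p.2}) hp _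

lemma measurableSet_upperHalf : MeasurableSet {p : Rn n × ℝ | 0 < p.2} :=
  measurableSet_lt measurable_const measurable_snd

lemma measurable_Abeta_restrict (hβ : 0 < β) (hβ1 : β ≤ 1) (hf : LocallyIntegrable f) :
    Measurable fun p : {p : Rn n × ℝ // 0 < p.2} => Abeta β f p.1.1 p.1.2 := by
  refine LowerSemicontinuous.measurable (lowerSemicontinuous_ciSup
    (fun p => bddAbove_convPhi hβ hβ1 hf p.2 p.1.1) fun φ => Continuous.lowerSemicontinuous ?_)
  rw [continuous_iff_continuousAt]
  intro p
  exact ((continuousAt_convPhi hβ hβ1 hf φ.2 p.1 p.2).comp continuousAt_subtype_val).abs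

lemma measurable_areaDensity (hβ : 0 < β) (hβ1 : β ≤ 1) (hf : LocallyIntegrable f) :
    Measurable (areaDensity β f) := by
  refine measurable_of_restrict_of_restrict_compl measurableSet_upperHalf ?_ ?_
  · have : {p : Rn n × ℝ | 0 < p.2}.domRestrict (areaDensity β f) = fun p =>
        ENNReal.ofReal (Abeta β f p.1.1 p.1.2 ^ 2 / p.1.2 ^ (n + 1)) := by
      ext p
      exact areaDensity_of_pos p.2
    rw [this]
    exact (((measurable_Abeta_restrict hβ hβ1 hf).pow_const 2).div
      ((measurable_snd.comp measurable_subtype_coe).pow_const _)).ennreal_ofReal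
  · have : {p : Rn n × ℝ | 0 < p.2}ᶜ.domRestrict (areaDensity β f) = fun _ => 0 := by
      ext p
      exact areaDensity_of_not_pos p.2
    rw [this]
    exact measurable_const

end Abeta

/-! ### Square functions over cones and the aperture comparison -/

/-- The integral of a density over the cone of aperture `γ` with vertex `x`. -/
def coneSq (G : Rn n × ℝ → ENNReal) (γ : ℝ) (x : Rn n) : ENNReal :=
  ∫⁻ p, {p : Rn n × ℝ | dist x p.1 < γ * p.2}.indicator G p

/-- The union of the balls in which `Ω` has relative `μ`-measure larger than `δ`. -/
def denseBalls (μ : Measure (Rn n)) (Ω : Set (Rn n)) (δ : ENNReal) : Set (Rn n) :=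
  {x | ∃ (y : Rn n) (r : ℝ), 0 < r ∧ x ∈ ball y r ∧ δ * μ (ball y r) < μ (Ω ∩ ball y r)}

lemma measurableSet_coneRel (γ : ℝ) :
    MeasurableSet {q : Rn n × (Rn n × ℝ) | dist q.1 q.2.1 < γ * q.2.2} :=
  (isOpen_lt (by fun_prop) (by fun_prop)).measurableSet

section Cone

variable {G : Rn n × ℝ → ENNReal} {γ : ℝ}

lemma measurable_coneKernel (hG : Measurable G) (γ : ℝ) :
    Measurable fun q : Rn n × (Rn n × ℝ) =>
      {p : Rn n × ℝ | dist q.1 p.1 < γ * p.2}.indicator G q.2 := by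
  have : (fun q : Rn n × (Rn n × ℝ) =>
      {p : Rn n × ℝ | dist q.1 p.1 < γ * p.2}.indicator G q.2) =
      {q : Rn n × (Rn n × ℝ) | dist q.1 q.2.1 < γ * q.2.2}.indicator (fun q => G q.2) := by
    ext q
    by_cases hq : dist q.1 q.2.1 < γ * q.2.2
    · rw [indicator_of_mem (by exact hq), indicator_of_mem (by exact hq)]
    · rw [indicator_of_notMem (by exact hq), indicator_of_notMem (by exact hq)]
  rw [this]
  exact (hG.comp measurable_snd).indicator (measurableSet_coneRel γ)

lemma measurable_coneSq (hG : Measurable G) (γ : ℝ) : Measurable (coneSq G γ) :=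
  (measurable_coneKernel hG γ).lintegral_prod_right'

lemma setLIntegral_coneSq (hG : Measurable G) (γ : ℝ) (μ : Measure (Rn n)) [SFinite μ]
    (B : Set (Rn n)) :
    ∫⁻ x in B, coneSq G γ x ∂μ = ∫⁻ p : Rn n × ℝ, G p * μ (B ∩ ball p.1 (γ * p.2)) := by
  simp only [coneSq]
  rw [lintegral_lintegral_swap (measurable_coneKernel hG γ).aemeasurable]
  refine lintegral_congr fun p => ?_
  have : ∀ x : Rn n, {p : Rn n × ℝ | dist x p.1 < γ * p.2}.indicator G p =
      (ball p.1 (γ * p.2)).indicator (fun _ => G p) x := fun x => by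
    by_cases hx : dist x p.1 < γ * p.2
    · rw [indicator_of_mem (by exact hx), indicator_of_mem (by exact hx)]
    · rw [indicator_of_notMem (by exact hx), indicator_of_notMem (by exact hx)]
  simp only [this]
  rw [lintegral_indicator_const measurableSet_ball, Measure.restrict_apply measurableSet_ball,
    inter_comm]

lemma coneSq_mono {γ' : ℝ} (hγ : γ ≤ γ') (hG : ∀ p : Rn n × ℝ, ¬ 0 < p.2 → G p = 0) (x : Rn n) :
    coneSq G γ x ≤ coneSq G γ' x := by
  refine lintegral_mono fun p => ?_
  by_cases hp : 0 < p.2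
  · by_cases hx : dist x p.1 < γ * p.2
    · have hx' : dist x p.1 < γ' * p.2 := hx.trans_le (by gcongr)
      rw [indicator_of_mem (by exact hx), indicator_of_mem (by exact hx')]
    · rw [indicator_of_notMem (by exact hx)]
      exact zero_le
  · rw [indicator_apply, hG p hp, ite_self]
    exact zero_le

end Cone

section Doubling

variable {μ : Measure (Rn n)} {C₀ : ENNReal}

/-- The weak type `(1,1)` bound of the maximal operator of a doubling measure, on indicators. -/
lemma mul_measure_denseBalls_le
    (hD : ∀ (y : Rn n) (r ρ : ℝ), 0 < r → 1 ≤ ρ →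
      μ (ball y (ρ * r)) ≤ C₀ * ENNReal.ofReal ρ ^ n * μ (ball y r))
    {Ω : Set (Rn n)} (hΩ : MeasurableSet Ω) (δ : ENNReal) :
    δ * μ (denseBalls μ Ω δ) ≤ C₀ * 4 ^ n * μ Ω := by
  set M : ℕ → Set (Rn n) := fun N => {x | ∃ (y : Rn n) (r : ℝ), 0 < r ∧ r ≤ N ∧ x ∈ ball y r ∧
    δ * μ (ball y r) < μ (Ω ∩ ball y r)} with hM
  have hU : denseBalls μ Ω δ = ⋃ N, M N := by
    ext x
    simp only [denseBalls, hM, mem_ofPred_eq, mem_iUnion]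
    constructor
    · rintro ⟨y, r, h1, h2, h3⟩
      obtain ⟨N, hN⟩ := exists_nat_ge r
      exact ⟨N, y, r, h1, hN, h2, h3⟩
    · rintro ⟨N, y, r, h1, -, h2, h3⟩
      exact ⟨y, r, h1, h2, h3⟩
  have hmono : Monotone M := by
    rintro N N' hN x ⟨y, r, h1, h2, h3⟩
    exact ⟨y, r, h1, h2.trans (by exact_mod_cast hN), h3⟩
  rw [hU, hmono.measure_iUnion, ENNReal.mul_iSup]
  refine iSup_le fun N => ?_
  obtain ⟨u, hut, hdisj, hcov⟩ := Vitali.exists_disjoint_subfamily_covering_enlargement_ball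
    {p : Rn n × ℝ | 0 < p.2 ∧ p.2 ≤ N ∧ δ * μ (ball p.1 p.2) < μ (Ω ∩ ball p.1 p.2)}
    Prod.fst Prod.snd N (fun p hp => hp.2.1) 4 (by norm_num)
  have hcount : u.Countable := hdisj.countable_of_isOpen (fun _ _ => isOpen_ball)
    fun p hp => nonempty_ball.2 (hut hp).1
  have hsub : M N ⊆ ⋃ p ∈ u, ball p.1 (4 * p.2) := by
    rintro x ⟨y, r, h1, h2, h3, h4⟩
    obtain ⟨b, hb, hsub⟩ := hcov (y, r) ⟨h1, h2, h4⟩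
    exact mem_biUnion hb (hsub h3)
  have hpair : u.PairwiseDisjoint fun p => Ω ∩ ball p.1 p.2 := fun p hp p' hp' hne =>
    (hdisj hp hp' hne).mono inter_subset_right inter_subset_right
  have : Countable u := hcount
  calc δ * μ (M N) ≤ δ * ∑' p : u, μ (ball p.1.1 (4 * p.1.2)) := by
        gcongr
        exact (measure_mono hsub).trans (measure_biUnion_le μ hcount _)
    _ = ∑' p : u, δ * μ (ball p.1.1 (4 * p.1.2)) := ENNReal.tsum_mul_left.symm
    _ ≤ ∑' p : u, C₀ * 4 ^ n * μ (Ω ∩ ball p.1.1 p.1.2) := by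
        refine ENNReal.tsum_le_tsum fun p => ?_
        have h1 := hD p.1.1 p.1.2 4 (hut p.2).1 (by norm_num)
        rw [ENNReal.ofReal_ofNat] at h1
        calc δ * μ (ball p.1.1 (4 * p.1.2)) ≤ δ * (C₀ * 4 ^ n * μ (ball p.1.1 p.1.2)) := by gcongr
          _ = C₀ * 4 ^ n * (δ * μ (ball p.1.1 p.1.2)) := by ring
          _ ≤ _ := by
            gcongr
            exact (hut p.2).2.2.le
    _ = C₀ * 4 ^ n * ∑' p : u, μ (Ω ∩ ball p.1.1 p.1.2) := ENNReal.tsum_mul_left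
    _ = C₀ * 4 ^ n * μ (⋃ p ∈ u, Ω ∩ ball p.1 p.2) := by
        rw [measure_biUnion hcount hpair fun p _ => hΩ.inter measurableSet_ball]
    _ ≤ C₀ * 4 ^ n * μ Ω := by
        gcongr
        exact iUnion₂_subset fun _ _ => inter_subset_left

/-- The `L²` estimate off the set where `Ω` is dense. -/
lemma setLIntegral_coneSq_le [IsLocallyFiniteMeasure μ] [SFinite μ]
    (hC₀ : C₀ ≠ 0) (hC₀' : C₀ ≠ ⊤)
    (hD : ∀ (y : Rn n) (r ρ : ℝ), 0 < r → 1 ≤ ρ →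
      μ (ball y (ρ * r)) ≤ C₀ * ENNReal.ofReal ρ ^ n * μ (ball y r))
    {G : Rn n × ℝ → ENNReal} (hG : Measurable G) (Ω : Set (Rn n))
    {ρ : ℝ} (hρ : 1 ≤ ρ) :
    ∫⁻ x in (denseBalls μ Ω (2 * (C₀ * ENNReal.ofReal ρ ^ n))⁻¹)ᶜ, coneSq G ρ x ∂μ ≤
      2 * (C₀ * ENNReal.ofReal ρ ^ n) * ∫⁻ x in Ωᶜ, coneSq G 1 x ∂μ := by
  set K := C₀ * ENNReal.ofReal ρ ^ n with hK
  have hρ0 : ENNReal.ofReal ρ ≠ 0 := by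
    rw [Ne, ENNReal.ofReal_eq_zero]; linarith
  have hK0 : K ≠ 0 := mul_ne_zero hC₀ (pow_ne_zero _ hρ0)
  have hKt : K ≠ ⊤ := ENNReal.mul_ne_top hC₀' (ENNReal.pow_ne_top ENNReal.ofReal_ne_top)
  rw [setLIntegral_coneSq hG ρ μ, setLIntegral_coneSq hG 1 μ, ← lintegral_const_mul' _ _ (by finiteness)]
  refine lintegral_mono fun p => ?_
  obtain ⟨y, t⟩ := p
  simp only [one_mul]
  rw [mul_left_comm (2 * K) (G (y, t))]
  refine mul_le_mul_right ?_ (G (y, t))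
  rcases le_or_gt t 0 with ht | ht
  · rw [ball_eq_empty.2 (by nlinarith), inter_empty, measure_empty]
    exact zero_le
  rcases ((denseBalls μ Ω (2 * K)⁻¹)ᶜ ∩ ball y (ρ * t)).eq_empty_or_nonempty with he | ⟨x, hx, hxb⟩
  · rw [he, measure_empty]
    exact zero_le
  have h1 : μ (Ω ∩ ball y (ρ * t)) ≤ (2 * K)⁻¹ * μ (ball y (ρ * t)) := by
    by_contra! hlt
    exact hx ⟨y, ρ * t, by positivity, hxb, hlt⟩
  have h2 : μ (Ω ∩ ball y t) ≤ 2⁻¹ * μ (ball y t) := by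
    calc μ (Ω ∩ ball y t) ≤ μ (Ω ∩ ball y (ρ * t)) := by
          gcongr
          nlinarith
      _ ≤ (2 * K)⁻¹ * (K * μ (ball y t)) := h1.trans (by gcongr; exact hD y t ρ ht hρ)
      _ = 2⁻¹ * μ (ball y t) := by
          rw [ENNReal.mul_inv (by simp) (by simp), mul_assoc, ← mul_assoc K⁻¹,
            ENNReal.inv_mul_cancel hK0 hKt, one_mul]
  have hfin : μ (ball y t) ≠ ⊤ := measure_ball_lt_top.ne
  have h3 : μ (ball y t) ≤ 2 * μ (Ωᶜ ∩ ball y t) := by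
    have h4 : μ (ball y t) ≤ 2⁻¹ * μ (ball y t) + μ (Ωᶜ ∩ ball y t) := by
      calc μ (ball y t) ≤ μ (Ω ∩ ball y t) + μ (Ωᶜ ∩ ball y t) := by
            refine (measure_mono fun z hz => ?_).trans (measure_union_le _ _)
            by_cases hzΩ : z ∈ Ω
            · exact Or.inl ⟨hzΩ, hz⟩
            · exact Or.inr ⟨hzΩ, hz⟩
        _ ≤ _ := by gcongr
    have h5 : μ (ball y t) = 2⁻¹ * μ (ball y t) + 2⁻¹ * μ (ball y t) := by
      rw [← add_mul, ENNReal.inv_two_add_inv_two, one_mul]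
    have h6 : 2⁻¹ * μ (ball y t) ≤ μ (Ωᶜ ∩ ball y t) := by
      exact ENNReal.le_of_add_le_add_left (by finiteness) (h5.symm.le.trans h4)
    calc μ (ball y t) = 2 * (2⁻¹ * μ (ball y t)) := by
          rw [← mul_assoc, ENNReal.mul_inv_cancel (by simp) (by simp), one_mul]
      _ ≤ _ := by gcongr
  calc μ ((denseBalls μ Ω (2 * K)⁻¹)ᶜ ∩ ball y (ρ * t)) ≤ μ (ball y (ρ * t)) := by
        gcongr
        exact inter_subset_right
    _ ≤ K * μ (ball y t) := hD y t ρ ht hρ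
    _ ≤ K * (2 * μ (Ωᶜ ∩ ball y t)) := by gcongr
    _ = 2 * K * μ (Ωᶜ ∩ ball y t) := by ring

end Doubling

/-! ### Integration over level sets -/

lemma lintegral_Ici_rpow {a c : ℝ} (ha : a < -1) (hc : 0 < c) :
    ∫⁻ s in Ici c, ENNReal.ofReal (s ^ a) = ENNReal.ofReal (-c ^ (a + 1) / (a + 1)) := by
  rw [setLIntegral_congr Ioi_ae_eq_Ici.symm, ← integral_Ioi_rpow_of_lt ha hc,
    ofReal_integral_eq_lintegral_ofReal (integrableOn_Ioi_rpow_of_lt ha hc)]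
  filter_upwards [ae_restrict_mem measurableSet_Ioi] with s hs
  have : 0 < s := hc.trans hs
  simp only [Pi.zero_apply]
  positivity

/-- A good-`λ` inequality with a quadratic tail implies a strong `L^q` inequality for `q < 2`. -/
lemma lintegral_rpow_le_of_measure_lt_le {μ : Measure (Rn n)} [SFinite μ] {q : ℝ} (hq0 : 0 < q)
    (hq2 : q < 2) {g₁ g₂ : Rn n → ℝ} (h₁ : Measurable g₁) (h₂ : Measurable g₂)
    (n₁ : ∀ x, 0 ≤ g₁ x) (n₂ : ∀ x, 0 ≤ g₂ x) {K : ENNReal} (hK : K ≠ ⊤)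
    (h : ∀ s : ℝ, 0 < s → μ {x | s < g₂ x} ≤ K * (μ {x | s < g₁ x} +
      ENNReal.ofReal (s ^ (-2 : ℝ)) * ∫⁻ x in {x | s < g₁ x}ᶜ, ENNReal.ofReal (g₁ x ^ 2) ∂μ)) :
    ∫⁻ x, ENNReal.ofReal (g₂ x ^ q) ∂μ ≤
      K * (1 + ENNReal.ofReal (q / (2 - q))) * ∫⁻ x, ENNReal.ofReal (g₁ x ^ q) ∂μ := by
  set F : ℝ → Rn n → ENNReal := fun s x => {p : ℝ × Rn n | g₁ p.2 ≤ p.1}.indicator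
    (fun p => ENNReal.ofReal (p.1 ^ (q - 3)) * ENNReal.ofReal (g₁ p.2 ^ 2)) (s, x) with hF
  have hFm : Measurable (Function.uncurry F) := by
    refine Measurable.indicator ?_ (measurableSet_le (h₁.comp measurable_snd) measurable_fst)
    exact ((measurable_fst.pow_const _).ennreal_ofReal).mul
      (((h₁.comp measurable_snd).pow_const 2).ennreal_ofReal)
  have hm1 : Measurable fun s : ℝ => μ {x | s < g₁ x} * ENNReal.ofReal (s ^ (q - 1)) := by
    refine Measurable.mul (Antitone.measurable fun s s' hs => ?_)
      (measurable_id.pow_const _).ennreal_ofReal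
    exact measure_mono fun x (hx : s' < g₁ x) => hs.trans_lt hx
  have hswap : ∫⁻ s in Ioi (0 : ℝ), ∫⁻ x, F s x ∂μ ≤
      ENNReal.ofReal (1 / (2 - q)) * ∫⁻ x, ENNReal.ofReal (g₁ x ^ q) ∂μ := by
    rw [lintegral_lintegral_swap hFm.aemeasurable, ← lintegral_const_mul' _ _ (by finiteness)]
    refine lintegral_mono fun x => ?_
    have e1 : ∀ s, F s x = (Ici (g₁ x)).indicator
        (fun s => ENNReal.ofReal (s ^ (q - 3)) * ENNReal.ofReal (g₁ x ^ 2)) s := fun s => by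
      by_cases hs : g₁ x ≤ s
      · rw [hF, indicator_of_mem (by exact hs)]
        exact (indicator_of_mem (s := {p : ℝ × Rn n | g₁ p.2 ≤ p.1}) (by exact hs) _)
      · rw [hF, indicator_of_notMem (by exact hs)]
        exact (indicator_of_notMem (s := {p : ℝ × Rn n | g₁ p.2 ≤ p.1}) (by exact hs) _)
    simp only [e1]
    rcases (n₁ x).eq_or_lt with h0 | h0
    · simp [← h0]
    calc _ ≤ ∫⁻ s, (Ici (g₁ x)).indicator
          (fun s => ENNReal.ofReal (s ^ (q - 3)) * ENNReal.ofReal (g₁ x ^ 2)) s :=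
          setLIntegral_le_lintegral _ _
      _ = ENNReal.ofReal (-g₁ x ^ (q - 3 + 1) / (q - 3 + 1)) * ENNReal.ofReal (g₁ x ^ 2) := by
          rw [lintegral_indicator measurableSet_Ici, lintegral_mul_const' _ _ (by finiteness),
            lintegral_Ici_rpow (by linarith) h0]
      _ = ENNReal.ofReal (1 / (2 - q)) * ENNReal.ofReal (g₁ x ^ q) := by
          have hq' : 0 < 2 - q := by linarith
          have e2 : -g₁ x ^ (q - 3 + 1) / (q - 3 + 1) = g₁ x ^ (q - 2) / (2 - q) := by
            rw [show q - 3 + 1 = -(2 - q) by ring, neg_div_neg_eq]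
            congr 2
            ring
          rw [e2, ← ENNReal.ofReal_mul (by positivity), ← ENNReal.ofReal_mul (by positivity)]
          congr 1
          rw [← Real.rpow_natCast, div_mul_eq_mul_div, ← Real.rpow_add h0]
          norm_num
          ring
      _ ≤ _ := le_rfl
  have hint : ∀ s ∈ Ioi (0 : ℝ), ENNReal.ofReal (s ^ (-2 : ℝ)) *
      (∫⁻ x in {x | s < g₁ x}ᶜ, ENNReal.ofReal (g₁ x ^ 2) ∂μ) * ENNReal.ofReal (s ^ (q - 1)) =
      ∫⁻ x, F s x ∂μ := fun s hs => by
    have hs : 0 < s := hs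
    have e1 : F s = {x | s < g₁ x}ᶜ.indicator
        (fun x => ENNReal.ofReal (s ^ (q - 3)) * ENNReal.ofReal (g₁ x ^ 2)) := by
      ext x
      by_cases hx : s < g₁ x
      · rw [indicator_of_notMem (by simpa using hx)]
        exact (indicator_of_notMem (s := {p : ℝ × Rn n | g₁ p.2 ≤ p.1}) (by simpa using hx) _)
      · rw [indicator_of_mem (by simpa using hx)]
        exact (indicator_of_mem (s := {p : ℝ × Rn n | g₁ p.2 ≤ p.1}) (by simpa using hx) _)
    rw [e1, lintegral_indicator (measurableSet_lt measurable_const h₁).compl,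
      lintegral_const_mul' _ _ (by finiteness), mul_right_comm,
      ← ENNReal.ofReal_mul (by positivity), ← Real.rpow_add hs]
    congr 3
    ring
  rw [lintegral_rpow_eq_lintegral_meas_lt_mul μ (Filter.Eventually.of_forall n₂)
    h₂.aemeasurable hq0]
  have hL1 := lintegral_rpow_eq_lintegral_meas_lt_mul μ (Filter.Eventually.of_forall n₁)
    h₁.aemeasurable hq0
  calc _ ≤ ENNReal.ofReal q * ∫⁻ s in Ioi (0 : ℝ),
        K * (μ {x | s < g₁ x} * ENNReal.ofReal (s ^ (q - 1)) + ∫⁻ x, F s x ∂μ) := by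
        refine mul_le_mul_right (setLIntegral_mono' measurableSet_Ioi fun s hs => ?_) _
        rw [← hint s hs, ← add_mul, ← mul_assoc]
        gcongr
        exact h s hs
    _ = K * (ENNReal.ofReal q * ∫⁻ s in Ioi (0 : ℝ),
          μ {x | s < g₁ x} * ENNReal.ofReal (s ^ (q - 1))) +
        K * (ENNReal.ofReal q * ∫⁻ s in Ioi (0 : ℝ), ∫⁻ x, F s x ∂μ) := by
        rw [lintegral_const_mul' _ _ hK, lintegral_add_left hm1]
        ring
    _ ≤ K * (∫⁻ x, ENNReal.ofReal (g₁ x ^ q) ∂μ) + K * (ENNReal.ofReal q *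
          (ENNReal.ofReal (1 / (2 - q)) * ∫⁻ x, ENNReal.ofReal (g₁ x ^ q) ∂μ)) := by
        rw [← hL1]
        gcongr
    _ = _ := by
        rw [← mul_assoc (ENNReal.ofReal q), ← ENNReal.ofReal_mul hq0.le, mul_one_div]
        ring

/-- Aperture comparison for the square functions of a density over cones, with respect to a
doubling measure. -/
lemma lintegral_coneSq_rpow_le {μ : Measure (Rn n)} [IsLocallyFiniteMeasure μ] [SFinite μ]
    {C₀ : ENNReal} (hC₀ : 1 ≤ C₀) (hC₀' : C₀ ≠ ⊤)
    (hD : ∀ (y : Rn n) (r ρ : ℝ), 0 < r → 1 ≤ ρ →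
      μ (ball y (ρ * r)) ≤ C₀ * ENNReal.ofReal ρ ^ n * μ (ball y r))
    {G : Rn n × ℝ → ENNReal} (hG : Measurable G) {q ρ : ℝ} (hq0 : 0 < q) (hq2 : q < 2)
    (hρ : 1 ≤ ρ) (hf : ∀ᵐ x ∂μ, coneSq G 1 x < ⊤) :
    ∫⁻ x, ENNReal.ofReal (((coneSq G ρ x).toReal ^ (1 / 2 : ℝ)) ^ q) ∂μ ≤
      2 * C₀ ^ 2 * 4 ^ n * ENNReal.ofReal ρ ^ n * (1 + ENNReal.ofReal (q / (2 - q))) *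
        ∫⁻ x, ENNReal.ofReal (((coneSq G 1 x).toReal ^ (1 / 2 : ℝ)) ^ q) ∂μ := by
  have hm : ∀ γ, Measurable fun x => (coneSq G γ x).toReal ^ (1 / 2 : ℝ) := fun γ =>
    (measurable_coneSq hG γ).ennreal_toReal.pow_const _
  have hsq : ∀ γ x, ((coneSq G γ x).toReal ^ (1 / 2 : ℝ)) ^ 2 = (coneSq G γ x).toReal :=
    fun γ x => by
      rw [← Real.sqrt_eq_rpow, Real.sq_sqrt ENNReal.toReal_nonneg]
  refine lintegral_rpow_le_of_measure_lt_le hq0 hq2 (hm 1) (hm ρ) (fun x => by positivity)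
    (fun x => by positivity) (by finiteness) fun s hs => ?_
  set Ω := {x | s < (coneSq G 1 x).toReal ^ (1 / 2 : ℝ)} with hΩ
  have hΩm : MeasurableSet Ω := measurableSet_lt measurable_const (hm 1)
  set K := C₀ * ENNReal.ofReal ρ ^ n with hK
  have hρ1 : 1 ≤ ENNReal.ofReal ρ := ENNReal.one_le_ofReal.2 hρ
  have hK1 : 1 ≤ K := one_le_mul hC₀ (one_le_pow₀ hρ1)
  have hKt : K ≠ ⊤ := by finiteness
  set M := denseBalls μ Ω (2 * K)⁻¹ with hM
  have h2K0 : 2 * K ≠ 0 := mul_ne_zero two_ne_zero (one_pos.trans_le hK1).ne'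
  have hMmeas : μ M ≤ 2 * K * (C₀ * 4 ^ n * μ Ω) := by
    have h1 := mul_measure_denseBalls_le hD hΩm (2 * K)⁻¹
    calc μ M = 2 * K * ((2 * K)⁻¹ * μ M) := by
          rw [← mul_assoc, ENNReal.mul_inv_cancel h2K0 (by finiteness), one_mul]
      _ ≤ _ := by gcongr
  have hL2 := setLIntegral_coneSq_le (μ := μ) (one_pos.trans_le hC₀).ne' hC₀' hD hG Ω hρ
  have hΩc : ∫⁻ x in Ωᶜ, coneSq G 1 x ∂μ = ∫⁻ x in Ωᶜ,
      ENNReal.ofReal (((coneSq G 1 x).toReal ^ (1 / 2 : ℝ)) ^ 2) ∂μ := by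
    refine lintegral_congr_ae ?_
    filter_upwards [ae_restrict_of_ae hf] with x hx
    rw [hsq, ENNReal.ofReal_toReal hx.ne]
  set I := ∫⁻ x in Ωᶜ, ENNReal.ofReal (((coneSq G 1 x).toReal ^ (1 / 2 : ℝ)) ^ 2) ∂μ
  have hs2 : ENNReal.ofReal (s ^ (-2 : ℝ)) = (ENNReal.ofReal (s ^ 2))⁻¹ := by
    rw [← ENNReal.ofReal_inv_of_pos (by positivity), Real.rpow_neg hs.le]
    norm_num
  have hcheb : μ ({x | s < (coneSq G ρ x).toReal ^ (1 / 2 : ℝ)} ∩ Mᶜ) ≤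
      ENNReal.ofReal (s ^ (-2 : ℝ)) * (2 * K * I) := by
    rw [hΩc] at hL2
    have hsub : {x | s < (coneSq G ρ x).toReal ^ (1 / 2 : ℝ)} ∩ Mᶜ ⊆
        {x | ENNReal.ofReal (s ^ 2) ≤ coneSq G ρ x} ∩ Mᶜ := by
      rintro x ⟨hx, hxM⟩
      refine ⟨?_, hxM⟩
      have hx : s < (coneSq G ρ x).toReal ^ (1 / 2 : ℝ) := hx
      have h3 : s ^ 2 ≤ (coneSq G ρ x).toReal := by
        rw [← hsq]
        gcongr
      exact (ENNReal.ofReal_le_ofReal h3).trans ENNReal.ofReal_toReal_le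
    have h4 := mul_meas_ge_le_lintegral (μ := μ.restrict Mᶜ) (measurable_coneSq hG ρ)
      (ENNReal.ofReal (s ^ 2))
    rw [Measure.restrict_apply (measurableSet_le measurable_const (measurable_coneSq hG ρ))] at h4
    have hs0 : ENNReal.ofReal (s ^ 2) ≠ 0 := by
      rw [Ne, ENNReal.ofReal_eq_zero, not_le]
      positivity
    calc _ ≤ μ ({x | ENNReal.ofReal (s ^ 2) ≤ coneSq G ρ x} ∩ Mᶜ) := measure_mono hsub
      _ = (ENNReal.ofReal (s ^ 2))⁻¹ * (ENNReal.ofReal (s ^ 2) *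
          μ ({x | ENNReal.ofReal (s ^ 2) ≤ coneSq G ρ x} ∩ Mᶜ)) := by
          rw [← mul_assoc, ENNReal.inv_mul_cancel hs0 (by finiteness), one_mul]
      _ ≤ _ := by
          rw [hs2]
          exact mul_le_mul_right (h4.trans hL2) _
  have h16 : (1 : ENNReal) ≤ C₀ * 4 ^ n := one_le_mul hC₀ (one_le_pow₀ (by norm_num))
  calc μ {x | s < (coneSq G ρ x).toReal ^ (1 / 2 : ℝ)}
      ≤ μ M + μ ({x | s < (coneSq G ρ x).toReal ^ (1 / 2 : ℝ)} ∩ Mᶜ) := by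
        refine (measure_mono fun x hx => ?_).trans (measure_union_le _ _)
        by_cases hxM : x ∈ M
        · exact Or.inl hxM
        · exact Or.inr ⟨hx, hxM⟩
    _ ≤ 2 * K * (C₀ * 4 ^ n * μ Ω) + ENNReal.ofReal (s ^ (-2 : ℝ)) * (2 * K * I) := by gcongr
    _ = 2 * K * (C₀ * 4 ^ n) * μ Ω + 2 * K * 1 * (ENNReal.ofReal (s ^ (-2 : ℝ)) * I) := by ring
    _ ≤ 2 * K * (C₀ * 4 ^ n) * μ Ω +
        2 * K * (C₀ * 4 ^ n) * (ENNReal.ofReal (s ^ (-2 : ℝ)) * I) := by gcongr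
    _ = _ := by
        rw [hK]
        ring

/-! ### A dyadic grid in the upper half space -/

/-- The scale of generation `k`. -/
def gridScale (R : ℝ) (k : ℕ) : ℝ := R / 2 ^ k

/-- The grid point of generation `k` with integer coordinates `m`. -/
def gridPoint (R : ℝ) (i : ℕ × (Fin n → ℤ)) : Rn n :=
  WithLp.toLp 2 fun l => gridScale R i.1 * (i.2 l : ℝ)

lemma gridScale_pos {R : ℝ} (hR : 0 < R) (k : ℕ) : 0 < gridScale R k := by
  unfold gridScale
  positivity

lemma gridScale_add (R : ℝ) (k l : ℕ) : gridScale R (k + l) = gridScale R k / 2 ^ l := by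
  unfold gridScale
  rw [pow_add, div_div]

lemma exists_dist_gridPoint_lt {R : ℝ} (hR : 0 < R) (k : ℕ) (y : Rn n) :
    ∃ m : Fin n → ℤ, dist y (gridPoint R (k, m)) < (n + 1) * gridScale R k := by
  have hs := gridScale_pos hR k
  set s := gridScale R k
  refine ⟨fun l => ⌊y l / s⌋, ?_⟩
  rw [dist_eq_norm]
  refine lt_of_pow_lt_pow_left₀ 2 (by positivity) ?_
  rw [EuclideanSpace.real_norm_sq_eq]
  have h1 : ∀ l, (y - gridPoint R (k, fun l => ⌊y l / s⌋)) l ^ 2 ≤ s ^ 2 := fun l => by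
    have h2 : (y - gridPoint R (k, fun l => ⌊y l / s⌋)) l = s * Int.fract (y l / s) := by
      change y l - s * (⌊y l / s⌋ : ℝ) = _
      rw [Int.fract, mul_sub, mul_div_cancel₀ _ hs.ne']
    rw [h2, mul_pow]
    have h3 := Int.fract_nonneg (y l / s)
    have h4 := (Int.fract_lt_one (y l / s)).le
    have h5 : Int.fract (y l / s) ^ 2 ≤ 1 := pow_le_one₀ h3 h4
    nlinarith [sq_nonneg s]
  calc _ ≤ ∑ _l : Fin n, s ^ 2 := Finset.sum_le_sum fun l _ => h1 l
    _ = n * s ^ 2 := by simp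
    _ < ((n + 1) * s) ^ 2 := by
      rw [mul_pow]
      gcongr
      nlinarith [(Nat.cast_nonneg n : (0 : ℝ) ≤ n)]

/-- The number of grid points of a given generation in a ball. -/
lemma card_gridPoint_le {R : ℝ} (hR : 0 < R) (k : ℕ) (z : Rn n) {b : ℝ} (hb : 0 ≤ b)
    (S : Finset (ℕ × (Fin n → ℤ)))
    (hS : ∀ i ∈ S, i.1 = k ∧ dist (gridPoint R i) z ≤ b * gridScale R k) :
    (S.card : ℝ) ≤ (2 * b + 1) ^ n := by
  have hs := gridScale_pos hR k
  set s := gridScale R k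
  let T : Finset (Fin n → ℤ) := Fintype.piFinset fun l =>
    Finset.Icc ⌈z l / s - b⌉ ⌊z l / s + b⌋
  have hmaps : ∀ i ∈ S, i.2 ∈ T := fun i hi => by
    obtain ⟨h1, h2⟩ := hS i hi
    refine Fintype.mem_piFinset.2 fun l => ?_
    have h3 : |gridPoint R i l - z l| ≤ b * s := by
      have h := EuclideanSpace.norm_eq (gridPoint R i - z)
      have h' : |(gridPoint R i - z) l| ≤ ‖gridPoint R i - z‖ := by
        simpa using PiLp.norm_apply_le (gridPoint R i - z) l
      rw [dist_eq_norm] at h2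
      exact h'.trans h2
    have h4 : gridPoint R i l = s * (i.2 l : ℝ) := by
      change gridScale R i.1 * _ = _
      rw [h1]
    rw [h4, abs_le] at h3
    rw [Finset.mem_Icc, Int.ceil_le, Int.le_floor]
    constructor
    · rw [sub_le_iff_le_add, div_le_iff₀ hs]
      linarith
    · rw [← sub_le_iff_le_add, le_div_iff₀ hs]
      linarith
  have hinj : Set.InjOn Prod.snd (S : Set (ℕ × (Fin n → ℤ))) := fun i hi j hj hij =>
    Prod.ext ((hS i hi).1.trans (hS j hj).1.symm) hij
  have hcard : S.card ≤ T.card := Finset.card_le_card_of_injOn Prod.snd hmaps hinj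
  have hcard' : (T.card : ℝ) ≤ (2 * b + 1) ^ n := by
    rw [Fintype.card_piFinset, Nat.cast_prod]
    calc _ ≤ ∏ _l : Fin n, (2 * b + 1) := by
          refine Finset.prod_le_prod (fun _ _ => Nat.cast_nonneg _) fun l _ => ?_
          rw [Int.card_Icc]
          have h5 : ((⌊z l / s + b⌋ + 1 - ⌈z l / s - b⌉ : ℤ) : ℝ) ≤ 2 * b + 1 := by
            push_cast
            have := Int.floor_le (z l / s + b)
            have := Int.le_ceil (z l / s - b)
            linarith
          rcases le_total 0 (⌊z l / s + b⌋ + 1 - ⌈z l / s - b⌉) with h0 | h0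
          · have h6 : (((⌊z l / s + b⌋ + 1 - ⌈z l / s - b⌉).toNat : ℤ) : ℝ) =
                ((⌊z l / s + b⌋ + 1 - ⌈z l / s - b⌉ : ℤ) : ℝ) := by rw [Int.toNat_of_nonneg h0]
            rw [Int.cast_natCast] at h6
            rw [h6]
            exact h5
          · rw [Int.toNat_of_nonpos h0, Nat.cast_zero]
            positivity
      _ = (2 * b + 1) ^ n := by simp
  exact le_trans (by exact_mod_cast hcard) hcard'

lemma sum_pow_le_of_injOn {θ : ℝ} (h0 : 0 ≤ θ) (h1 : θ < 1) (S : Finset ℕ) (g : ℕ → ℕ)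
    (hg : Set.InjOn g S) : ∑ k ∈ S, θ ^ g k ≤ (1 - θ)⁻¹ := by
  rw [← Finset.sum_image (f := fun l => θ ^ l) hg, ← tsum_geometric_of_lt_one h0 h1]
  exact (summable_geometric_of_lt_one h0 h1).sum_le_tsum _ fun _ _ => by positivity

lemma sum_pow_dist_le {θ : ℝ} (h0 : 0 ≤ θ) (h1 : θ < 1) (S : Finset ℕ) (k : ℕ) :
    ∑ k' ∈ S, θ ^ (Nat.dist k k') ≤ 2 * (1 - θ)⁻¹ := by
  rw [← Finset.sum_filter_add_sum_filter_not S (fun k' => k ≤ k'), two_mul]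
  refine add_le_add (sum_pow_le_of_injOn h0 h1 _ _ ?_) (sum_pow_le_of_injOn h0 h1 _ _ ?_)
  · intro a ha b hb hab
    have ha' := (Finset.mem_filter.1 ha).2
    have hb' := (Finset.mem_filter.1 hb).2
    simp only [Nat.dist] at hab
    omega
  · intro a ha b hb hab
    have ha' := (Finset.mem_filter.1 ha).2
    have hb' := (Finset.mem_filter.1 hb).2
    simp only [Nat.dist] at hab
    omega

/-- Summation over grid points, generation by generation. -/
lemma sum_le_of_sum_level_le (S : Finset (ℕ × (Fin n → ℤ))) (F : ℕ × (Fin n → ℤ) → ℝ)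
    (u : ℕ → ℝ) (h : ∀ k ∈ S.image Prod.fst, ∑ i ∈ S with i.1 = k, F i ≤ u k) :
    ∑ i ∈ S, F i ≤ ∑ k ∈ S.image Prod.fst, u k := by
  rw [← Finset.sum_fiberwise_of_maps_to (s := S) (t := S.image Prod.fst) (g := Prod.fst)
    fun i hi => Finset.mem_image_of_mem _ hi]
  exact Finset.sum_le_sum h

/-- Schur's test for a finite symmetric matrix. -/
lemma sum_sum_mul_le_of_schur {ι : Type*} (S : Finset ι) (p a : ι → ℝ) (K κ : ι → ι → ℝ)
    (hp : ∀ i, 0 ≤ p i) (hK : ∀ i ∈ S, ∀ j ∈ S, |K i j| ≤ κ i j) (hsymm : ∀ i j, κ i j = κ j i)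
    {C : ℝ} (hrow : ∀ i ∈ S, ∑ j ∈ S, p j * κ i j ≤ C) :
    ∑ i ∈ S, ∑ j ∈ S, p i * a i * (p j * a j) * K i j ≤ C * ∑ i ∈ S, p i * a i ^ 2 := by
  have h1 : ∀ i ∈ S, ∀ j ∈ S, p i * a i * (p j * a j) * K i j ≤
      2⁻¹ * (p i * a i ^ 2 * (p j * κ i j)) + 2⁻¹ * (p j * a j ^ 2 * (p i * κ j i)) := by
    intro i hi j hj
    have h2 := hK i hi j hj
    have h3 : a i * a j * K i j ≤ 2⁻¹ * (a i ^ 2 + a j ^ 2) * κ i j := by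
      calc a i * a j * K i j ≤ |a i * a j * K i j| := le_abs_self _
        _ = |a i * a j| * |K i j| := abs_mul _ _
        _ ≤ 2⁻¹ * (a i ^ 2 + a j ^ 2) * κ i j := by
          gcongr
          rw [abs_le]
          constructor <;> nlinarith [sq_nonneg (a i + a j), sq_nonneg (a i - a j)]
    have h4 := mul_le_mul_of_nonneg_left h3 (mul_nonneg (hp i) (hp j))
    rw [hsymm j i]
    linarith
  have h5 : ∑ i ∈ S, p i * a i ^ 2 * ∑ j ∈ S, p j * κ i j ≤ C * ∑ i ∈ S, p i * a i ^ 2 := by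
    rw [mul_comm C, Finset.sum_mul]
    refine Finset.sum_le_sum fun i hi => ?_
    exact mul_le_mul_of_nonneg_left (hrow i hi) (mul_nonneg (hp i) (sq_nonneg _))
  calc _ ≤ ∑ i ∈ S, ∑ j ∈ S, (2⁻¹ * (p i * a i ^ 2 * (p j * κ i j)) +
        2⁻¹ * (p j * a j ^ 2 * (p i * κ j i))) :=
        Finset.sum_le_sum fun i hi => Finset.sum_le_sum fun j hj => h1 i hi j hj
    _ = 2⁻¹ * ∑ i ∈ S, p i * a i ^ 2 * ∑ j ∈ S, p j * κ i j +
        2⁻¹ * ∑ j ∈ S, p j * a j ^ 2 * ∑ i ∈ S, p i * κ j i := by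
        simp only [Finset.sum_add_distrib, Finset.mul_sum]
        congr 1
        exact Finset.sum_comm
    _ = ∑ i ∈ S, p i * a i ^ 2 * ∑ j ∈ S, p j * κ i j := by ring
    _ ≤ _ := h5

section Packets

variable {β R A : ℝ} {ψ : ℕ × (Fin n → ℤ) → Rn n → ℝ}

/-- The superposition of bumps `ψ i` with coefficients `b i`. -/
def packetSum (R : ℝ) (S : Finset (ℕ × (Fin n → ℤ))) (b : ℕ × (Fin n → ℤ) → ℝ)
    (ψ : ℕ × (Fin n → ℤ) → Rn n → ℝ) (z : Rn n) : ℝ :=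
  ∑ i ∈ S, gridScale R i.1 ^ n * b i * ψ i z

/-- A bound for the inner product of two bumps of a dyadic family. -/
def packetKernel (β R A : ℝ) (i j : ℕ × (Fin n → ℤ)) : ℝ :=
  if dist (gridPoint R i) (gridPoint R j) ≤ A * (gridScale R i.1 + gridScale R j.1) then
    3 * volume.real (ball (0 : Rn n) 1) *
      (((A * gridScale R (min i.1 j.1)) ^ n)⁻¹ * ((1 / 2 : ℝ) ^ β) ^ Nat.dist i.1 j.1)
  else 0

lemma packetKernel_comm (i j : ℕ × (Fin n → ℤ)) :
    packetKernel β R A i j = packetKernel β R A j i := by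
  unfold packetKernel
  rw [dist_comm, add_comm, min_comm, Nat.dist_comm]

lemma gridScale_le_of_le (hR : 0 < R) {k l : ℕ} (h : k ≤ l) : gridScale R l ≤ gridScale R k := by
  unfold gridScale
  gcongr
  norm_num

lemma div_gridScale_rpow (hR : 0 < R) (hA : 0 < A) {k l : ℕ} (h : k ≤ l) :
    (A * gridScale R l / (A * gridScale R k)) ^ β = ((1 / 2 : ℝ) ^ β) ^ Nat.dist k l := by
  obtain ⟨m, rfl⟩ := Nat.exists_eq_add_of_le h
  have h1 : A * gridScale R (k + m) / (A * gridScale R k) = (1 / 2 : ℝ) ^ m := by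
    have := gridScale_pos hR k
    rw [gridScale_add, one_div, inv_pow]
    field_simp
  have h2 : Nat.dist k (k + m) = m := by simp only [Nat.dist]; omega
  rw [h1, h2, ← Real.rpow_natCast, ← Real.rpow_natCast, ← Real.rpow_mul (by norm_num),
    ← Real.rpow_mul (by norm_num), mul_comm]

lemma abs_integral_packet_le (hβ : 0 < β) (hR : 0 < R) (hA : 0 < A) {i j : ℕ × (Fin n → ℤ)}
    (hi : IsBump β (ψ i) (gridPoint R i) (A * gridScale R i.1))
    (hj : IsBump β (ψ j) (gridPoint R j) (A * gridScale R j.1)) :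
    |∫ z, ψ i z * ψ j z| ≤ packetKernel β R A i j := by
  wlog h : i.1 ≤ j.1 generalizing i j
  · rw [packetKernel_comm]
    simpa only [mul_comm] using this hj hi (le_of_not_ge h)
  have hsi := mul_pos hA (gridScale_pos hR i.1)
  have hsj := mul_pos hA (gridScale_pos hR j.1)
  unfold packetKernel
  split_ifs with hd
  · rw [min_eq_left h, ← div_gridScale_rpow hR hA h]
    exact hi.abs_integral_mul_bump_le hβ hsi hj hsj
  · rw [hi.integral_mul_bump_eq_zero hj (by linarith), abs_zero]

lemma sum_packetKernel_level_le (hR : 0 < R) (hA : 1 ≤ A) (i : ℕ × (Fin n → ℤ)) (k : ℕ)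
    (S : Finset (ℕ × (Fin n → ℤ))) (hS : ∀ j ∈ S, j.1 = k) :
    ∑ j ∈ S, gridScale R j.1 ^ n * packetKernel β R A i j ≤
      3 * volume.real (ball (0 : Rn n) 1) * 5 ^ n * ((1 / 2 : ℝ) ^ β) ^ Nat.dist i.1 k := by
  have hA0 : 0 < A := by linarith
  set v := volume.real (ball (0 : Rn n) 1)
  have hv : 0 ≤ v := measureReal_nonneg
  set τ := ((1 / 2 : ℝ) ^ β) ^ Nat.dist i.1 k with hτ
  have hτ0 : 0 ≤ τ := by positivity
  have hk := gridScale_pos hR k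
  have hik := gridScale_pos hR (min i.1 k)
  set T := S.filter fun j => dist (gridPoint R i) (gridPoint R j) ≤
    A * (gridScale R i.1 + gridScale R j.1)
  have e1 : ∑ j ∈ S, gridScale R j.1 ^ n * packetKernel β R A i j =
      (T.card : ℝ) * (gridScale R k ^ n * (3 * v * (((A * gridScale R (min i.1 k)) ^ n)⁻¹ * τ))) := by
    rw [← nsmul_eq_mul, ← Finset.sum_const, Finset.sum_filter]
    refine Finset.sum_congr rfl fun j hj => ?_
    unfold packetKernel
    rw [hS j hj]
    split_ifs
    · rfl
    · simp
  have hcard : (T.card : ℝ) ≤ (5 * A * gridScale R (min i.1 k) / gridScale R k) ^ n := by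
    have hm : gridScale R k ≤ gridScale R (min i.1 k) := gridScale_le_of_le hR (min_le_right _ _)
    have hm' : gridScale R i.1 ≤ gridScale R (min i.1 k) := gridScale_le_of_le hR (min_le_left _ _)
    have hsi := gridScale_pos hR i.1
    refine (card_gridPoint_le hR k (gridPoint R i)
      (b := 2 * A * gridScale R (min i.1 k) / gridScale R k) (by positivity) T fun j hj => ?_).trans ?_
    · obtain ⟨hj1, hj2⟩ := Finset.mem_filter.1 hj
      have := hS j hj1
      refine ⟨this, ?_⟩
      rw [dist_comm, div_mul_cancel₀ _ hk.ne']
      rw [this] at hj2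
      nlinarith
    · gcongr
      rw [← sub_nonneg]
      have : 5 * A * gridScale R (min i.1 k) / gridScale R k -
          (2 * (2 * A * gridScale R (min i.1 k) / gridScale R k) + 1) =
          (A * gridScale R (min i.1 k) - gridScale R k) / gridScale R k := by
        field_simp
        ring
      rw [this]
      apply div_nonneg _ hk.le
      nlinarith
  rw [e1]
  calc _ ≤ (5 * A * gridScale R (min i.1 k) / gridScale R k) ^ n *
        (gridScale R k ^ n * (3 * v * (((A * gridScale R (min i.1 k)) ^ n)⁻¹ * τ))) := by gcongr
    _ = _ := by
      rw [div_pow, mul_assoc 5 A, mul_pow 5]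
      have : (A * gridScale R (min i.1 k)) ^ n ≠ 0 := by positivity
      field_simp

lemma half_rpow_lt_one (hβ : 0 < β) : (1 / 2 : ℝ) ^ β < 1 :=
  Real.rpow_lt_one (by norm_num) (by norm_num) hβ

/-- The constant in the almost orthogonality estimate. -/
def packetConst (n : ℕ) (β : ℝ) : ℝ :=
  3 * volume.real (ball (0 : Rn n) 1) * 5 ^ n * (2 * (1 - (1 / 2 : ℝ) ^ β)⁻¹)

lemma packetConst_nonneg (hβ : 0 < β) : 0 ≤ packetConst n β := by
  have := half_rpow_lt_one hβ
  have : 0 < 1 - (1 / 2 : ℝ) ^ β := by linarith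
  unfold packetConst
  positivity

lemma sum_packetKernel_le (hβ : 0 < β) (hR : 0 < R) (hA : 1 ≤ A) (i : ℕ × (Fin n → ℤ))
    (S : Finset (ℕ × (Fin n → ℤ))) :
    ∑ j ∈ S, gridScale R j.1 ^ n * packetKernel β R A i j ≤ packetConst n β := by
  refine (sum_le_of_sum_level_le S _ (fun k => 3 * volume.real (ball (0 : Rn n) 1) * 5 ^ n *
    ((1 / 2 : ℝ) ^ β) ^ Nat.dist i.1 k) fun k _ => ?_).trans ?_
  · exact sum_packetKernel_level_le hR hA i k _ fun j hj => (Finset.mem_filter.1 hj).2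
  · rw [← Finset.mul_sum]
    unfold packetConst
    gcongr
    exact sum_pow_dist_le (by positivity) (half_rpow_lt_one hβ) _ _

variable {S : Finset (ℕ × (Fin n → ℤ))} {b : ℕ × (Fin n → ℤ) → ℝ}

lemma continuous_packetSum (hβ : 0 < β) (hR : 0 < R) (hA : 0 < A)
    (hψ : ∀ i ∈ S, IsBump β (ψ i) (gridPoint R i) (A * gridScale R i.1)) :
    Continuous (packetSum R S b ψ) :=
  continuous_finsetSum _ fun i hi =>
    continuous_const.mul ((hψ i hi).continuous hβ (mul_pos hA (gridScale_pos hR _)))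

lemma hasCompactSupport_packetSum
    (hψ : ∀ i ∈ S, IsBump β (ψ i) (gridPoint R i) (A * gridScale R i.1)) :
    HasCompactSupport (packetSum R S b ψ) := by
  refine HasCompactSupport.intro (K := ⋃ i ∈ S, closedBall (gridPoint R i) (A * gridScale R i.1))
    (S.isCompact_biUnion fun i _ => isCompact_closedBall _ _) fun z hz => ?_
  refine Finset.sum_eq_zero fun i hi => ?_
  by_contra hne
  exact hz (mem_biUnion (s := (S : Set (ℕ × (Fin n → ℤ)))) hi
    (mem_closedBall.2 ((hψ i hi).support z (right_ne_zero_of_mul hne))))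

lemma integral_packetSum_sq_le (hβ : 0 < β) (hR : 0 < R) (hA : 1 ≤ A)
    (hψ : ∀ i ∈ S, IsBump β (ψ i) (gridPoint R i) (A * gridScale R i.1)) :
    ∫ z, packetSum R S b ψ z ^ 2 ≤ packetConst n β * ∑ i ∈ S, gridScale R i.1 ^ n * b i ^ 2 := by
  have hA0 : 0 < A := by linarith
  have hs : ∀ i : ℕ × (Fin n → ℤ), 0 < A * gridScale R i.1 :=
    fun i => mul_pos hA0 (gridScale_pos hR _)
  have hint : ∀ i ∈ S, ∀ j ∈ S, Integrable fun z => ψ i z * ψ j z := fun i hi j hj =>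
    (hψ j hj).integrable_mul hβ (hs j) ((hψ i hi).continuous hβ (hs i)).locallyIntegrable
  have e1 : ∫ z, packetSum R S b ψ z ^ 2 = ∑ i ∈ S, ∑ j ∈ S, gridScale R i.1 ^ n * b i *
      (gridScale R j.1 ^ n * b j) * ∫ z, ψ i z * ψ j z := by
    have : ∀ z, packetSum R S b ψ z ^ 2 = ∑ i ∈ S, ∑ j ∈ S, gridScale R i.1 ^ n * b i *
        (gridScale R j.1 ^ n * b j) * (ψ i z * ψ j z) := fun z => by
      rw [packetSum, sq, Finset.sum_mul_sum]
      exact Finset.sum_congr rfl fun i _ => Finset.sum_congr rfl fun j _ => by ring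
    simp only [this]
    rw [integral_finsetSum _ fun i hi => integrable_finsetSum _ fun j hj =>
      (hint i hi j hj).const_mul _]
    refine Finset.sum_congr rfl fun i hi => ?_
    rw [integral_finsetSum _ fun j hj => (hint i hi j hj).const_mul _]
    exact Finset.sum_congr rfl fun j _ => integral_const_mul _ _
  rw [e1]
  exact sum_sum_mul_le_of_schur S _ b _ (packetKernel β R A)
    (fun i => (pow_pos (gridScale_pos hR _) _).le)
    (fun i hi j hj => abs_integral_packet_le hβ hR hA0 (hψ i hi) (hψ j hj)) packetKernel_comm
    fun i _ => sum_packetKernel_le hβ hR hA i S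

end Packets

section Oscillation

variable {β R A : ℝ} {ψ : ℕ × (Fin n → ℤ) → Rn n → ℝ} {S : Finset (ℕ × (Fin n → ℤ))}
  {b : ℕ × (Fin n → ℤ) → ℝ}

/-- A packet sum whose bumps all live near `E` oscillates little on Whitney balls off `E`. -/
lemma abs_packetSum_sub_le (hβ : 0 < β) (hR : 0 < R) (hA : 1 ≤ A) {B Λ : ℝ} (hB : 0 ≤ B)
    (hΛ : 0 ≤ Λ) (hψ : ∀ i ∈ S, IsBump β (ψ i) (gridPoint R i) (A * gridScale R i.1))
    (hb : ∀ i ∈ S, |b i| ≤ Λ) {E : Set (Rn n)}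
    (hE : ∀ i ∈ S, ∃ x ∈ E, dist x (gridPoint R i) ≤ B * gridScale R i.1) {z z' : Rn n}
    (hd : 0 < infDist z E) (hz : dist z z' ≤ infDist z E / 2) :
    |packetSum R S b ψ z - packetSum R S b ψ z'| ≤
      Λ * (2 * (2 * (A + B)) + 1) ^ n * (2 * (A + B)) ^ β * (1 - (1 / 2 : ℝ) ^ β)⁻¹ := by
  set d := infDist z E
  set T := 2 * (A + B) with hT
  set θ := (1 / 2 : ℝ) ^ β with hθ
  have hθ1 : 0 < 1 - θ := by linarith [half_rpow_lt_one hβ]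
  have hT0 : 0 < T := by linarith
  set S' := S.filter fun i => ψ i z ≠ 0 ∨ ψ i z' ≠ 0 with hS'
  have hsub : ∀ i ∈ S', i ∈ S := fun i hi => (Finset.mem_filter.1 hi).1
  have hnear : ∀ i ∈ S', d ≤ T * gridScale R i.1 ∧ dist (gridPoint R i) z ≤ T * gridScale R i.1 := by
    intro i hi
    obtain ⟨hiS, hne⟩ := Finset.mem_filter.1 hi
    obtain ⟨x, hx, hxd⟩ := hE i hiS
    have hs := gridScale_pos hR i.1
    have h1 : d ≤ dist z x := infDist_le_dist_of_mem hx
    have hBs : 0 ≤ B * gridScale R i.1 := by positivity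
    have hAs : 0 ≤ A * gridScale R i.1 := by positivity
    rw [dist_comm] at hxd
    have hTs : T * gridScale R i.1 = 2 * (A * gridScale R i.1) + 2 * (B * gridScale R i.1) := by
      rw [hT]; ring
    rcases hne with hne | hne
    · have h2 := (hψ i hiS).support z hne
      have h3 := dist_triangle z (gridPoint R i) x
      rw [dist_comm _ z]
      constructor <;> linarith
    · have h2 := (hψ i hiS).support z' hne
      have h3 := dist_triangle z (gridPoint R i) x
      have h4 := dist_triangle z z' (gridPoint R i)
      rw [dist_comm _ z]
      constructor <;> linarith
  have e1 : packetSum R S b ψ z - packetSum R S b ψ z' =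
      ∑ i ∈ S', gridScale R i.1 ^ n * b i * (ψ i z - ψ i z') := by
    rw [packetSum, packetSum, ← Finset.sum_sub_distrib, hS', Finset.sum_filter]
    refine Finset.sum_congr rfl fun i _ => ?_
    split_ifs with h
    · ring
    · rw [not_or, not_not, not_not] at h
      rw [h.1, h.2]
      ring
  have hterm : ∀ i ∈ S', |gridScale R i.1 ^ n * b i * (ψ i z - ψ i z')| ≤
      Λ * (d / gridScale R i.1) ^ β := by
    intro i hi
    have hs := gridScale_pos hR i.1
    have hA0 : 0 < A := by linarith
    rw [abs_mul, abs_mul, abs_of_nonneg (pow_nonneg hs.le n)]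
    calc _ ≤ gridScale R i.1 ^ n * Λ * (((A * gridScale R i.1) ^ n)⁻¹ *
          (dist z z' / (A * gridScale R i.1)) ^ β) := by
          gcongr
          · exact hb i (hsub i hi)
          · exact (hψ i (hsub i hi)).holder z z'
      _ ≤ gridScale R i.1 ^ n * Λ * ((gridScale R i.1 ^ n)⁻¹ * (d / gridScale R i.1) ^ β) := by
          gcongr
          · exact le_mul_of_one_le_left hs.le hA
          · linarith
          · exact le_mul_of_one_le_left hs.le hA
      _ = _ := by field_simp
  rw [e1]
  refine (Finset.abs_sum_le_sum_abs _ _).trans ((Finset.sum_le_sum hterm).trans ?_)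
  rcases S'.eq_empty_or_nonempty with h0 | h0
  · rw [h0, Finset.sum_empty]
    positivity
  have himg : (S'.image Prod.fst).Nonempty := h0.image _
  set k₀ := (S'.image Prod.fst).max' himg
  have hk₀ : d ≤ T * gridScale R k₀ := by
    obtain ⟨i, hi, hik⟩ := Finset.mem_image.1 ((S'.image Prod.fst).max'_mem himg)
    have := (hnear i hi).1
    rwa [hik] at this
  have hs₀ := gridScale_pos hR k₀
  have hle : ∀ k ∈ S'.image Prod.fst, k ≤ k₀ := fun k hk => Finset.le_max' _ k hk
  refine (sum_le_of_sum_level_le S' _ (fun k => (2 * T + 1) ^ n * (Λ * (T ^ β * θ ^ (k₀ - k))))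
    fun k hk => ?_).trans ?_
  · have hk' := hle k hk
    have hs := gridScale_pos hR k
    have hpow : (d / gridScale R k) ^ β ≤ T ^ β * θ ^ (k₀ - k) := by
      have h1 := div_gridScale_rpow (β := β) hR one_pos hk'
      rw [one_mul, one_mul] at h1
      have h2 : Nat.dist k k₀ = k₀ - k := by simp only [Nat.dist]; omega
      rw [← h2, hθ, ← h1, ← Real.mul_rpow hT0.le (by positivity)]
      gcongr
      rw [mul_div_assoc']
      gcongr
    have hcard := card_gridPoint_le hR k z hT0.le (S'.filter fun i => i.1 = k) fun i hi => by
      obtain ⟨hi1, hi2⟩ := Finset.mem_filter.1 hi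
      have := (hnear i hi1).2
      rw [hi2] at this
      exact ⟨hi2, this⟩
    calc _ = ∑ i ∈ S' with i.1 = k, Λ * (d / gridScale R k) ^ β :=
          Finset.sum_congr rfl fun i hi => by rw [(Finset.mem_filter.1 hi).2]
      _ = ((S'.filter fun i => i.1 = k).card : ℝ) * (Λ * (d / gridScale R k) ^ β) := by
          rw [Finset.sum_const, nsmul_eq_mul]
      _ ≤ _ := by gcongr
  · rw [← Finset.mul_sum, ← Finset.mul_sum, ← Finset.mul_sum]
    calc _ ≤ (2 * T + 1) ^ n * (Λ * (T ^ β * (1 - θ)⁻¹)) := by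
          gcongr
          refine sum_pow_le_of_injOn (by positivity) (by linarith) _ _ fun a ha b hb hab => ?_
          have := hle a ha
          have := hle b hb
          omega
      _ = _ := by ring

end Oscillation

section Whitney

variable {E : Set (Rn n)} {φ : Rn n → ENNReal} {L : ℝ}

lemma ae_le_of_setLIntegral_closedBall_le (hφ : Measurable φ) (hφi : ∫⁻ z, φ z ≠ ⊤)
    (hE : ∀ x ∈ E, ∀ r : ℝ, 0 < r → ∫⁻ z in closedBall x r, φ z ≤ ENNReal.ofReal (L * r ^ n)) :
    ∀ᵐ x, x ∈ closure E → φ x ≤ ENNReal.ofReal (L * 2 ^ n) / volume (ball (0 : Rn n) 1) := by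
  filter_upwards [(Besicovitch.vitaliFamily (volume : Measure (Rn n))).ae_tendsto_lintegral_div
    hφ.aemeasurable hφi] with x hx hxE
  have h1 := hx.comp (Besicovitch.tendsto_filterAt volume x)
  refine le_of_tendsto h1 ?_
  filter_upwards [self_mem_nhdsWithin] with r (hr : 0 < r)
  obtain ⟨y, hy, hxy⟩ := Metric.mem_closure_iff.1 hxE r hr
  have h2 : ∫⁻ z in closedBall x r, φ z ≤ ENNReal.ofReal (L * 2 ^ n) * ENNReal.ofReal (r ^ n) := by
    calc _ ≤ ∫⁻ z in closedBall y (2 * r), φ z :=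
          lintegral_mono_set (closedBall_subset_closedBall' (by linarith))
      _ ≤ _ := hE y hy _ (by positivity)
      _ = _ := by rw [← ENNReal.ofReal_mul' (by positivity), mul_pow, mul_assoc]
  change (∫⁻ z in closedBall x r, φ z) / volume (closedBall x r) ≤ _
  rw [Measure.addHaar_closedBall _ _ hr.le, finrank_euclideanSpace, Fintype.card_fin]
  have hr0 : ENNReal.ofReal (r ^ n) ≠ 0 := (ENNReal.ofReal_pos.2 (by positivity)).ne'
  refine (ENNReal.div_le_div_right h2 _).trans (le_of_eq ?_)
  rw [mul_comm (ENNReal.ofReal (r ^ n)), ENNReal.mul_div_mul_right _ _ hr0 ENNReal.ofReal_ne_top]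

/-- The kernel averaging over half Whitney balls off `E`. -/
def whitneyKernel (E : Set (Rn n)) (z z' : Rn n) : ENNReal :=
  {q : Rn n × Rn n | dist q.1 q.2 < infDist q.1 E / 2}.indicator (fun q =>
    (ENNReal.ofReal ((infDist q.1 E / 2) ^ n) * volume (ball (0 : Rn n) 1))⁻¹) (z, z')

lemma whitneyKernel_of_not_lt {z z' : Rn n} (h : ¬ dist z z' < infDist z E / 2) :
    whitneyKernel E z z' = 0 := by
  unfold whitneyKernel
  rw [indicator_of_notMem (by exact h)]

lemma measurable_whitneyKernel : Measurable (Function.uncurry (whitneyKernel E)) := by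
  have hc : Continuous fun q : Rn n × Rn n => infDist q.1 E :=
    (continuous_infDist_pt E).comp continuous_fst
  refine Measurable.indicator (f := fun q : Rn n × Rn n =>
    (ENNReal.ofReal ((infDist q.1 E / 2) ^ n) * volume (ball (0 : Rn n) 1))⁻¹) ?_
    (isOpen_lt continuous_dist (hc.div_const 2)).measurableSet
  exact (((hc.div_const 2).pow n).measurable.ennreal_ofReal.mul_const _).inv

lemma measurable_whitneyKernel_right (z : Rn n) : Measurable (whitneyKernel E z) :=
  Measurable.of_uncurry_left (f := whitneyKernel E) measurable_whitneyKernel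

lemma lintegral_whitneyKernel {z : Rn n} (hz : 0 < infDist z E) :
    ∫⁻ z', whitneyKernel E z z' = 1 := by
  have h1 : ∀ z', whitneyKernel E z z' = (ball z (infDist z E / 2)).indicator (fun _ =>
      (ENNReal.ofReal ((infDist z E / 2) ^ n) * volume (ball (0 : Rn n) 1))⁻¹) z' := fun z' => by
    unfold whitneyKernel
    by_cases h : dist z z' < infDist z E / 2
    · rw [indicator_of_mem (by exact h), indicator_of_mem (by rwa [mem_ball, dist_comm])]
    · rw [indicator_of_notMem (by exact h), indicator_of_notMem (by rwa [mem_ball, dist_comm])]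
  simp only [h1]
  rw [lintegral_indicator measurableSet_ball, setLIntegral_const,
    Measure.addHaar_ball_of_pos _ _ (half_pos hz), finrank_euclideanSpace, Fintype.card_fin]
  refine ENNReal.inv_mul_cancel ?_ ?_
  · exact mul_ne_zero (ENNReal.ofReal_pos.2 (by positivity)).ne' (measure_ball_pos _ _ one_pos).ne'
  · exact ENNReal.mul_ne_top ENNReal.ofReal_ne_top measure_ball_lt_top.ne

lemma lintegral_whitneyKernel_le (z : Rn n) : ∫⁻ z', whitneyKernel E z z' ≤ 1 := by
  rcases (infDist_nonneg (x := z) (s := E)).eq_or_lt with h0 | h0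
  · have : ∀ z', whitneyKernel E z z' = 0 := fun z' => whitneyKernel_of_not_lt (by simp [← h0])
    simp [this]
  · exact (lintegral_whitneyKernel h0).le

/-- The averages of `φ` over the Whitney balls that see `z'`. -/
def whitneyAverage (E : Set (Rn n)) (φ : Rn n → ENNReal) (z' : Rn n) : ENNReal :=
  ∫⁻ z, φ z * whitneyKernel E z z'

lemma measurable_mul_whitneyKernel (hφ : Measurable φ) :
    Measurable fun q : Rn n × Rn n => φ q.1 * whitneyKernel E q.1 q.2 :=
  (hφ.comp measurable_fst).mul measurable_whitneyKernel

lemma measurable_whitneyAverage (hφ : Measurable φ) : Measurable (whitneyAverage E φ) :=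
  ((measurable_mul_whitneyKernel hφ).comp measurable_swap).lintegral_prod_right'

lemma lintegral_whitneyAverage_le (hφ : Measurable φ) :
    ∫⁻ z', whitneyAverage E φ z' ≤ ∫⁻ z, φ z := by
  unfold whitneyAverage
  rw [lintegral_lintegral_swap (f := fun z' z => φ z * whitneyKernel E z z')
    ((measurable_mul_whitneyKernel hφ).comp measurable_swap).aemeasurable]
  refine lintegral_mono fun z => ?_
  rw [lintegral_const_mul _ (measurable_whitneyKernel_right z)]
  exact mul_le_of_le_one_right' (lintegral_whitneyKernel_le z)

lemma whitneyAverage_le (hEn : E.Nonempty)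
    (hE : ∀ x ∈ E, ∀ r : ℝ, 0 < r → ∫⁻ z in closedBall x r, φ z ≤ ENNReal.ofReal (L * r ^ n))
    (z' : Rn n) :
    whitneyAverage E φ z' ≤ ENNReal.ofReal (L * 9 ^ n) / volume (ball (0 : Rn n) 1) := by
  set v := volume (ball (0 : Rn n) 1)
  set D := infDist z' E
  have hcmp : ∀ z, dist z z' < infDist z E / 2 → 2 / 3 * D ≤ infDist z E ∧ dist z z' < D := by
    intro z hz
    have h1 : infDist z E ≤ D + dist z z' := infDist_le_infDist_add_dist
    have h2 : D ≤ infDist z E + dist z' z := infDist_le_infDist_add_dist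
    rw [dist_comm] at h2
    constructor <;> linarith
  rcases (infDist_nonneg (x := z') (s := E)).eq_or_lt with h0 | h0
  · have : ∀ z, whitneyKernel E z z' = 0 := fun z => by
      refine whitneyKernel_of_not_lt fun h => ?_
      have h1 := (hcmp z h).2
      have h2 : D = 0 := h0.symm
      linarith [dist_nonneg (x := z) (y := z')]
    simp [whitneyAverage, this]
  · change 0 < D at h0
    obtain ⟨x, hx, hxz⟩ := (infDist_lt_iff hEn).1 (show infDist z' E < 2 * D by linarith)
    have hker : ∀ z, whitneyKernel E z z' ≤ (closedBall x (3 * D)).indicator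
        (fun _ => (ENNReal.ofReal ((D / 3) ^ n) * v)⁻¹) z := by
      intro z
      by_cases hz : dist z z' < infDist z E / 2
      · obtain ⟨h1, h2⟩ := hcmp z hz
        have h3 : z ∈ closedBall x (3 * D) := by
          have := dist_triangle z z' x
          rw [mem_closedBall]
          linarith
        unfold whitneyKernel
        rw [indicator_of_mem (by exact hz), indicator_of_mem h3]
        have h4 : D / 3 ≤ infDist z E / 2 := by linarith
        dsimp only
        gcongr
      · unfold whitneyKernel
        rw [indicator_of_notMem (by exact hz)]
        exact zero_le
    calc whitneyAverage E φ z' ≤ ∫⁻ z, (closedBall x (3 * D)).indicator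
          (fun z => φ z * (ENNReal.ofReal ((D / 3) ^ n) * v)⁻¹) z := by
          refine lintegral_mono fun z => ?_
          refine (mul_le_mul_right (hker z) (φ z)).trans (le_of_eq ?_)
          by_cases h : z ∈ closedBall x (3 * D)
          · rw [indicator_of_mem h, indicator_of_mem h]
          · rw [indicator_of_notMem h, indicator_of_notMem h, mul_zero]
      _ = (∫⁻ z in closedBall x (3 * D), φ z) * (ENNReal.ofReal ((D / 3) ^ n) * v)⁻¹ := by
          rw [lintegral_indicator measurableSet_closedBall, lintegral_mul_const']
          refine ENNReal.inv_ne_top.2 (mul_ne_zero (ENNReal.ofReal_pos.2 (by positivity)).ne'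
            (measure_ball_pos _ _ one_pos).ne')
      _ ≤ ENNReal.ofReal (L * (3 * D) ^ n) * (ENNReal.ofReal ((D / 3) ^ n) * v)⁻¹ := by
          gcongr
          exact hE x hx _ (by positivity)
      _ = _ := by
          have h5 : L * (3 * D) ^ n = (L * 9 ^ n) * (D / 3) ^ n := by
            rw [mul_assoc, ← mul_pow]
            congr 2
            ring
          have h6 : ENNReal.ofReal ((D / 3) ^ n) ≠ 0 :=
            (ENNReal.ofReal_pos.2 (by positivity)).ne'
          rw [h5, ENNReal.ofReal_mul' (by positivity), ← div_eq_mul_inv, mul_comm _ v,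
            ENNReal.mul_div_mul_right _ _ h6 ENNReal.ofReal_ne_top]

lemma le_add_lintegral_whitneyKernel {z : Rn n} (hd : 0 < infDist z E) {H : Rn n → ENNReal}
    {K : ENNReal}
    (hosc : ∀ z', dist z z' < infDist z E / 2 → H z ≤ K + H z') :
    H z ≤ K + ∫⁻ z', whitneyKernel E z z' * H z' := by
  have hm := measurable_whitneyKernel_right (E := E) z
  calc H z = ∫⁻ z', whitneyKernel E z z' * H z := by
        rw [lintegral_mul_const _ hm, lintegral_whitneyKernel hd, one_mul]
    _ ≤ ∫⁻ z', (whitneyKernel E z z' * K + whitneyKernel E z z' * H z') := by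
        refine lintegral_mono fun z' => ?_
        rw [← mul_add]
        by_cases h : dist z z' < infDist z E / 2
        · exact mul_le_mul_right (hosc z' h) _
        · simp [whitneyKernel_of_not_lt h]
    _ = _ := by
        rw [lintegral_add_left (hm.mul_const _), lintegral_mul_const _ hm,
          lintegral_whitneyKernel hd, one_mul]

/-- Testing `φ` against a function with bounded oscillation off `E`. -/
lemma lintegral_mul_le_of_oscillation (hL : 0 ≤ L) (hφ : Measurable φ) (hφi : ∫⁻ z, φ z ≠ ⊤)
    (hEn : E.Nonempty)
    (hE : ∀ x ∈ E, ∀ r : ℝ, 0 < r → ∫⁻ z in closedBall x r, φ z ≤ ENNReal.ofReal (L * r ^ n))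
    {H : Rn n → ENNReal} (hH : Measurable H) {K : ENNReal}
    (hosc : ∀ z z', dist z z' < infDist z E / 2 → H z ≤ K + H z') {ε : ENNReal} (hε : ε ≠ 0)
    (hε' : ε ≠ ⊤) :
    ∫⁻ z, φ z * H z ≤ (K + 2 * ε⁻¹) * (∫⁻ z, φ z) +
      ε * (2 * (ENNReal.ofReal (L * 9 ^ n) / volume (ball (0 : Rn n) 1))) * ∫⁻ z, H z ^ 2 := by
  set M := ENNReal.ofReal (L * 9 ^ n) / volume (ball (0 : Rn n) 1)
  set F := whitneyAverage E φ
  set P := (closure E).indicator φ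
  have hF : Measurable F := measurable_whitneyAverage hφ
  have hP : Measurable P := hφ.indicator isClosed_closure.measurableSet
  have hsplit : ∀ z, φ z * H z ≤ P z * H z + (K * φ z + ∫⁻ z', φ z * whitneyKernel E z z' * H z') := by
    intro z
    by_cases hz : z ∈ closure E
    · simp only [P, indicator_of_mem hz]
      exact le_self_add
    · have hd : 0 < infDist z E := (infDist_pos_iff_notMem_closure hEn).1 hz
      have hm := measurable_whitneyKernel_right (E := E) z
      have h1 := le_add_lintegral_whitneyKernel hd (hosc z)
      refine le_trans ?_ le_add_self
      calc φ z * H z ≤ φ z * (K + ∫⁻ z', whitneyKernel E z z' * H z') := by gcongr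
        _ = _ := by
          simp only [mul_assoc]
          rw [mul_add, mul_comm _ K, lintegral_const_mul _ (by fun_prop)]
  have hswap : ∫⁻ z, ∫⁻ z', φ z * whitneyKernel E z z' * H z' = ∫⁻ z', F z' * H z' := by
    rw [lintegral_lintegral_swap (f := fun z z' => φ z * whitneyKernel E z z' * H z')
      ((measurable_mul_whitneyKernel hφ).mul (hH.comp measurable_snd)).aemeasurable]
    refine lintegral_congr fun z' => ?_
    exact lintegral_mul_const _ ((measurable_mul_whitneyKernel hφ).comp measurable_prodMk_right)
  have hyoung : ∀ u : ENNReal, u ≤ ε⁻¹ + ε * u ^ 2 := by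
    intro u
    rcases le_total u ε⁻¹ with h | h
    · exact h.trans le_self_add
    · refine le_trans ?_ le_add_self
      have h1 : 1 ≤ ε * u := by
        rw [← ENNReal.mul_inv_cancel hε hε']
        gcongr
      calc u = 1 * u := (one_mul u).symm
        _ ≤ ε * u * u := by gcongr
        _ = _ := by ring
  have hbound : ∀ {Q : Rn n → ENNReal}, Measurable Q → (∀ᵐ z, Q z ≤ M) → ∫⁻ z, Q z ≤ ∫⁻ z, φ z →
      ∫⁻ z, Q z * H z ≤ ε⁻¹ * (∫⁻ z, φ z) + ε * M * ∫⁻ z, H z ^ 2 := by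
    intro Q hQ hQM hQi
    calc ∫⁻ z, Q z * H z ≤ ∫⁻ z, (ε⁻¹ * Q z + ε * M * H z ^ 2) := by
          refine lintegral_mono_ae ?_
          filter_upwards [hQM] with z hz
          calc Q z * H z ≤ Q z * (ε⁻¹ + ε * H z ^ 2) := by gcongr; exact hyoung _
            _ = ε⁻¹ * Q z + ε * Q z * H z ^ 2 := by ring
            _ ≤ _ := by gcongr
      _ = ε⁻¹ * (∫⁻ z, Q z) + ε * M * ∫⁻ z, H z ^ 2 := by
          rw [lintegral_add_left (hQ.const_mul _), lintegral_const_mul _ hQ,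
            lintegral_const_mul _ (hH.pow_const 2)]
      _ ≤ _ := by gcongr
  have hPM : ∀ᵐ z, P z ≤ M := by
    filter_upwards [ae_le_of_setLIntegral_closedBall_le hφ hφi hE] with z hz
    by_cases h : z ∈ closure E
    · simp only [P, indicator_of_mem h]
      refine (hz h).trans ?_
      simp only [M]
      gcongr
      norm_num
    · simp only [P, indicator_of_notMem h]
      exact zero_le
  have hP1 := hbound hP hPM (lintegral_mono fun z => indicator_le_self _ _ z)
  have hF1 := hbound hF (Filter.Eventually.of_forall (whitneyAverage_le hEn hE))
    (lintegral_whitneyAverage_le hφ)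
  calc ∫⁻ z, φ z * H z ≤
      ∫⁻ z, (P z * H z + (K * φ z + ∫⁻ z', φ z * whitneyKernel E z z' * H z')) :=
        lintegral_mono hsplit
    _ = (∫⁻ z, P z * H z) + (K * (∫⁻ z, φ z) + ∫⁻ z', F z' * H z') := by
        rw [lintegral_add_left (by fun_prop), lintegral_add_left (hφ.const_mul _),
          lintegral_const_mul _ hφ, hswap]
    _ ≤ (ε⁻¹ * (∫⁻ z, φ z) + ε * M * ∫⁻ z, H z ^ 2) + (K * (∫⁻ z, φ z) +
        (ε⁻¹ * (∫⁻ z, φ z) + ε * M * ∫⁻ z, H z ^ 2)) := by gcongr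
    _ = _ := by ring

end Whitney

section Carleson

variable {β : ℝ} {f : Rn n → ℝ} {E : Set (Rn n)} {L : ℝ}

lemma setIntegral_abs_le_of_lintegral_le {s : Set (Rn n)} {c : ℝ} (hc : 0 ≤ c)
    (hf : AEStronglyMeasurable f) (h : ∫⁻ z in s, ‖f z‖ₑ ≤ ENNReal.ofReal c) :
    ∫ z in s, |f z| ≤ c := by
  have : ∫ z in s, |f z| = (∫⁻ z in s, ‖f z‖ₑ).toReal :=
    integral_norm_eq_lintegral_enorm hf.restrict
  rw [this]
  exact ENNReal.toReal_le_of_le_ofReal hc h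

lemma Abeta_le_of_near (hβ : 0 < β) (hβ1 : β ≤ 1) (hf : LocallyIntegrable f) (hL : 0 ≤ L)
    (hE : ∀ x ∈ E, ∀ r : ℝ, 0 < r → ∫⁻ z in closedBall x r, ‖f z‖ₑ ≤ ENNReal.ofReal (L * r ^ n))
    {A B s : ℝ} (hA : 1 ≤ A) (hB : 0 ≤ B) (hs : 0 < s) {c : Rn n}
    (hc : ∃ x ∈ E, dist x c ≤ B * s) : Abeta β f c (A * s) ≤ 3 * L * (A + B) ^ n := by
  obtain ⟨x, hx, hxc⟩ := hc
  have hA0 : 0 < A := by linarith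
  have h1 : ∫ z in closedBall c (A * s), |f z| ≤ L * ((A + B) * s) ^ n := by
    refine setIntegral_abs_le_of_lintegral_le (by positivity) hf.aestronglyMeasurable
      ((lintegral_mono_set ?_).trans (hE x hx _ (by positivity)))
    refine closedBall_subset_closedBall' ?_
    rw [dist_comm]
    linarith
  refine (Abeta_le hβ hβ1 hf (by positivity) c).trans ?_
  calc _ ≤ 3 * (s ^ n)⁻¹ * (L * ((A + B) * s) ^ n) := by
        gcongr
        exact le_mul_of_one_le_left hs.le hA
    _ = _ := by
        rw [mul_pow]
        field_simp

lemma lintegral_mul_le_of_oscillation₀ {φ : Rn n → ENNReal} (hL : 0 ≤ L) (hφ : AEMeasurable φ)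
    (hφi : ∫⁻ z, φ z ≠ ⊤) (hEn : E.Nonempty)
    (hE : ∀ x ∈ E, ∀ r : ℝ, 0 < r → ∫⁻ z in closedBall x r, φ z ≤ ENNReal.ofReal (L * r ^ n))
    {H : Rn n → ENNReal} (hH : Measurable H) {K : ENNReal}
    (hosc : ∀ z z', dist z z' < infDist z E / 2 → H z ≤ K + H z') {ε : ENNReal} (hε : ε ≠ 0)
    (hε' : ε ≠ ⊤) :
    ∫⁻ z, φ z * H z ≤ (K + 2 * ε⁻¹) * (∫⁻ z, φ z) +
      ε * (2 * (ENNReal.ofReal (L * 9 ^ n) / volume (ball (0 : Rn n) 1))) * ∫⁻ z, H z ^ 2 := by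
  obtain ⟨g, hg, hfg⟩ := hφ
  have hgs : ∀ s : Set (Rn n), ∫⁻ z in s, g z = ∫⁻ z in s, φ z := fun s =>
    lintegral_congr_ae (ae_restrict_of_ae hfg.symm)
  have hgi : ∫⁻ z, φ z = ∫⁻ z, g z := lintegral_congr_ae hfg
  have h1 : ∫⁻ z, φ z * H z = ∫⁻ z, g z * H z := lintegral_congr_ae (hfg.mul (ae_eq_refl H))
  rw [h1, hgi]
  exact lintegral_mul_le_of_oscillation hL hg (by rwa [← hgi]) hEn
    (fun x hx r hr => by rw [hgs]; exact hE x hx r hr) hH hosc hε hε'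

lemma lintegral_enorm_sq_of_continuous {h : Rn n → ℝ} (hc : Continuous h)
    (hs : HasCompactSupport h) : ∫⁻ z, ‖h z‖ₑ ^ 2 = ENNReal.ofReal (∫ z, h z ^ 2) := by
  have h0 : HasCompactSupport fun z => h z ^ 2 := by
    simp only [sq]
    exact hs.mul_right
  have h1 : Integrable fun z => h z ^ 2 := (hc.pow 2).integrable_of_hasCompactSupport h0
  rw [ofReal_integral_eq_lintegral_ofReal h1 (Filter.Eventually.of_forall fun z => sq_nonneg (h z))]
  refine lintegral_congr fun z => ?_
  rw [Real.enorm_eq_ofReal_abs, ← ENNReal.ofReal_pow (abs_nonneg _), sq_abs]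

lemma lintegral_packetSum_sq_le {R A : ℝ} {ψ : ℕ × (Fin n → ℤ) → Rn n → ℝ}
    {S : Finset (ℕ × (Fin n → ℤ))} {b : ℕ × (Fin n → ℤ) → ℝ} (hβ : 0 < β) (hR : 0 < R)
    (hA : 1 ≤ A) (hψ : ∀ i ∈ S, IsBump β (ψ i) (gridPoint R i) (A * gridScale R i.1)) :
    ∫⁻ z, ‖packetSum R S b ψ z‖ₑ ^ 2 ≤
      ENNReal.ofReal (packetConst n β * ∑ i ∈ S, gridScale R i.1 ^ n * b i ^ 2) := by
  have hhc := continuous_packetSum (b := b) hβ hR (by linarith) hψ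
  have hhs := hasCompactSupport_packetSum (b := b) hψ
  rw [lintegral_enorm_sq_of_continuous hhc hhs]
  exact ENNReal.ofReal_le_ofReal (integral_packetSum_sq_le hβ hR hA hψ)

lemma sum_coeff_sq_eq_integral {R A : ℝ} {ψ : ℕ × (Fin n → ℤ) → Rn n → ℝ}
    {S : Finset (ℕ × (Fin n → ℤ))} {b : ℕ × (Fin n → ℤ) → ℝ} (hβ : 0 < β) (hR : 0 < R)
    (hA : 1 ≤ A) (hf : LocallyIntegrable f)
    (hψ : ∀ i ∈ S, IsBump β (ψ i) (gridPoint R i) (A * gridScale R i.1))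
    (hb : ∀ i ∈ S, b i = ∫ z, f z * ψ i z) :
    ∑ i ∈ S, gridScale R i.1 ^ n * b i ^ 2 = ∫ z, f z * packetSum R S b ψ z := by
  simp only [packetSum, Finset.mul_sum]
  rw [integral_finsetSum]
  · refine Finset.sum_congr rfl fun i hi => ?_
    rw [sq, ← mul_assoc]
    nth_rewrite 2 [hb i hi]
    rw [← integral_const_mul]
    exact integral_congr_ae (Filter.Eventually.of_forall fun z => by ring)
  · intro i hi
    have := ((hψ i hi).integrable_mul hβ
      (mul_pos (by linarith) (gridScale_pos hR _)) hf).const_mul (gridScale R i.1 ^ n * b i)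
    exact this.congr (Filter.Eventually.of_forall fun z => by ring)

/-- The self-improving estimate for the coefficients of a packet sum. -/
lemma ofReal_sum_coeff_sq_le {R A B Λ ε : ℝ} {ψ : ℕ × (Fin n → ℤ) → Rn n → ℝ}
    {S : Finset (ℕ × (Fin n → ℤ))} {b : ℕ × (Fin n → ℤ) → ℝ} (hβ : 0 < β) (hR : 0 < R)
    (hA : 1 ≤ A) (hB : 0 ≤ B) (hf : Integrable f) (hL : 0 ≤ L) (hEn : E.Nonempty)
    (hE : ∀ x ∈ E, ∀ r : ℝ, 0 < r → ∫⁻ z in closedBall x r, ‖f z‖ₑ ≤ ENNReal.ofReal (L * r ^ n))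
    (hψ : ∀ i ∈ S, IsBump β (ψ i) (gridPoint R i) (A * gridScale R i.1))
    (hb : ∀ i ∈ S, b i = ∫ z, f z * ψ i z) (hΛ0 : 0 ≤ Λ) (hbΛ : ∀ i ∈ S, |b i| ≤ Λ)
    (hS : ∀ i ∈ S, ∃ x ∈ E, dist x (gridPoint R i) ≤ B * gridScale R i.1) (hε0 : 0 < ε) :
    ENNReal.ofReal (∑ i ∈ S, gridScale R i.1 ^ n * b i ^ 2) ≤
      (ENNReal.ofReal (Λ * (2 * (2 * (A + B)) + 1) ^ n * (2 * (A + B)) ^ β *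
        (1 - (1 / 2 : ℝ) ^ β)⁻¹) + 2 * (ENNReal.ofReal ε)⁻¹) * (∫⁻ z, ‖f z‖ₑ) +
      ENNReal.ofReal ε * (2 * (ENNReal.ofReal (L * 9 ^ n) / volume (ball (0 : Rn n) 1))) *
        ENNReal.ofReal (packetConst n β * ∑ i ∈ S, gridScale R i.1 ^ n * b i ^ 2) := by
  set Λ' := Λ * (2 * (2 * (A + B)) + 1) ^ n * (2 * (A + B)) ^ β * (1 - (1 / 2 : ℝ) ^ β)⁻¹
  have hosc : ∀ z z', dist z z' < infDist z E / 2 →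
      ‖packetSum R S b ψ z‖ₑ ≤ ENNReal.ofReal Λ' + ‖packetSum R S b ψ z'‖ₑ := by
    intro z z' hz
    have hd : 0 < infDist z E := by linarith [dist_nonneg (x := z) (y := z')]
    have h1 := abs_packetSum_sub_le hβ hR hA hB hΛ0 hψ hbΛ hS hd hz.le
    calc ‖packetSum R S b ψ z‖ₑ
        = ‖packetSum R S b ψ z - packetSum R S b ψ z' + packetSum R S b ψ z'‖ₑ := by
          rw [sub_add_cancel]
      _ ≤ ‖packetSum R S b ψ z - packetSum R S b ψ z'‖ₑ + ‖packetSum R S b ψ z'‖ₑ :=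
          enorm_add_le _ _
      _ ≤ _ := by
        gcongr
        rw [Real.enorm_eq_ofReal_abs]
        exact ENNReal.ofReal_le_ofReal h1
  have hhc := continuous_packetSum (b := b) hβ hR (by linarith) hψ
  have hmain := lintegral_mul_le_of_oscillation₀ hL hf.1.enorm hf.2.ne hEn hE
    hhc.enorm.measurable hosc (ENNReal.ofReal_pos.2 hε0).ne' ENNReal.ofReal_ne_top
  have h2 : ENNReal.ofReal (∑ i ∈ S, gridScale R i.1 ^ n * b i ^ 2) ≤
      ∫⁻ z, ‖f z‖ₑ * ‖packetSum R S b ψ z‖ₑ := by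
    rw [sum_coeff_sq_eq_integral hβ hR hA hf.locallyIntegrable hψ hb]
    refine (ENNReal.ofReal_le_ofReal (le_abs_self _)).trans ?_
    rw [← Real.enorm_eq_ofReal_abs]
    refine (enorm_integral_le_lintegral_enorm _).trans (le_of_eq ?_)
    simp only [enorm_mul]
  refine h2.trans (hmain.trans ?_)
  gcongr
  exact lintegral_packetSum_sq_le hβ hR hA hψ

/-- A discrete Carleson packing estimate above a set where the maximal function is bounded. -/
lemma exists_sum_Abeta_sq_le (hβ : 0 < β) (hβ1 : β ≤ 1) (hf : Integrable f) (hL : 0 ≤ L)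
    (hE : ∀ x ∈ E, ∀ r : ℝ, 0 < r → ∫⁻ z in closedBall x r, ‖f z‖ₑ ≤ ENNReal.ofReal (L * r ^ n))
    {R A B : ℝ} (hR : 0 < R) (hA : 1 ≤ A) (hB : 0 ≤ B) :
    ∃ C : ℝ, 0 ≤ C ∧ ∀ S : Finset (ℕ × (Fin n → ℤ)),
      (∀ i ∈ S, ∃ x ∈ E, dist x (gridPoint R i) ≤ B * gridScale R i.1) →
      ∑ i ∈ S, gridScale R i.1 ^ n * Abeta β f (gridPoint R i) (A * gridScale R i.1) ^ 2 ≤ C := by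
  have hA0 : 0 < A := by linarith
  have hfl := hf.locallyIntegrable
  have hsc : ∀ i : ℕ × (Fin n → ℤ), 0 < A * gridScale R i.1 :=
    fun i => mul_pos hA0 (gridScale_pos hR _)
  set Λ := 3 * L * (A + B) ^ n with hΛ
  have hΛ0 : 0 ≤ Λ := by positivity
  set Λ' := Λ * (2 * (2 * (A + B)) + 1) ^ n * (2 * (A + B)) ^ β * (1 - (1 / 2 : ℝ) ^ β)⁻¹
  have hC₂ := packetConst_nonneg (n := n) hβ
  set M := 2 * (ENNReal.ofReal (L * 9 ^ n) / volume (ball (0 : Rn n) 1)) with hM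
  have hMt : M ≠ ⊤ := ENNReal.mul_ne_top (by norm_num) (ENNReal.div_ne_top ENNReal.ofReal_ne_top
    (measure_ball_pos _ _ one_pos).ne')
  set ε : ℝ := (2 * (M.toReal * packetConst n β + 1))⁻¹ with hε
  have hε0 : 0 < ε := by positivity
  have hεM : ε * M.toReal * packetConst n β ≤ 1 / 2 := by
    rw [hε, mul_assoc, inv_mul_le_iff₀ (by positivity)]
    linarith
  set N := (ENNReal.ofReal Λ' + 2 * (ENNReal.ofReal ε)⁻¹) * ∫⁻ z, ‖f z‖ₑ with hN
  have hNt : N ≠ ⊤ := by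
    refine ENNReal.mul_ne_top (ENNReal.add_ne_top.2 ⟨ENNReal.ofReal_ne_top, ?_⟩) hf.2.ne
    exact ENNReal.mul_ne_top (by norm_num) (ENNReal.inv_ne_top.2 (ENNReal.ofReal_pos.2 hε0).ne')
  refine ⟨8 * N.toReal, by positivity, fun S hS => ?_⟩
  rcases S.eq_empty_or_nonempty with rfl | ⟨i₀, hi₀⟩
  · rw [Finset.sum_empty]
    positivity
  have hEn : E.Nonempty := by
    obtain ⟨x, hx, _⟩ := hS i₀ hi₀
    exact ⟨x, hx⟩
  choose φ hφ hφA using fun i : ℕ × (Fin n → ℤ) =>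
    exists_Abeta_le_two_mul (β := β) (f := f) (gridPoint R i) (A * gridScale R i.1)
  set ψ := fun i : ℕ × (Fin n → ℤ) => dilKernel (φ i) (A * gridScale R i.1) (gridPoint R i)
  set b := fun i : ℕ × (Fin n → ℤ) => convPhi f (φ i) (A * gridScale R i.1) (gridPoint R i)
  have hψ : ∀ i ∈ S, IsBump β (ψ i) (gridPoint R i) (A * gridScale R i.1) :=
    fun i _ => (hφ i).isBump hβ hβ1 (hsc i) _
  have hb : ∀ i ∈ S, |b i| ≤ Λ := fun i hi =>
    (abs_convPhi_le_Abeta hβ hβ1 hfl (hsc i) _ (hφ i)).trans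
      (Abeta_le_of_near hβ hβ1 hfl hL hE hA hB (gridScale_pos hR _) (hS i hi))
  set X := ∑ i ∈ S, gridScale R i.1 ^ n * b i ^ 2 with hX
  have hX0 : 0 ≤ X := Finset.sum_nonneg fun i _ =>
    mul_nonneg (pow_pos (gridScale_pos hR _) _).le (sq_nonneg _)
  have hself := ofReal_sum_coeff_sq_le hβ hR hA hB hf hL hEn hE hψ (fun i _ => rfl) hΛ0 hb hS hε0
  have hXle : ENNReal.ofReal X ≤ ENNReal.ofReal (N.toReal + X / 2) := by
    calc ENNReal.ofReal X ≤ N + ENNReal.ofReal ε * M * ENNReal.ofReal (packetConst n β * X) := hself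
      _ = ENNReal.ofReal (N.toReal + ε * M.toReal * packetConst n β * X) := by
          rw [ENNReal.ofReal_add (by positivity) (by positivity), ENNReal.ofReal_toReal hNt,
            mul_assoc (ε * M.toReal), ENNReal.ofReal_mul (p := ε * M.toReal) (by positivity),
            ENNReal.ofReal_mul (p := ε) (by positivity), ENNReal.ofReal_toReal hMt]
      _ ≤ _ := by
          refine ENNReal.ofReal_le_ofReal ?_
          have := mul_le_mul_of_nonneg_right hεM hX0
          linarith
  have hXN : X ≤ 2 * N.toReal := by
    have := (ENNReal.ofReal_le_ofReal_iff (by positivity)).1 hXle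
    linarith
  calc _ ≤ ∑ i ∈ S, 4 * (gridScale R i.1 ^ n * b i ^ 2) := by
        refine Finset.sum_le_sum fun i _ => ?_
        have h1 := hφA i
        have h2 := Abeta_nonneg (β := β) (f := f) (gridPoint R i) (A * gridScale R i.1)
        have h3 := pow_le_pow_left₀ h2 h1 2
        calc _ ≤ gridScale R i.1 ^ n * (2 * b i) ^ 2 :=
              mul_le_mul_of_nonneg_left h3 (pow_pos (gridScale_pos hR _) _).le
          _ = _ := by ring
    _ = 4 * X := by rw [hX, Finset.mul_sum]
    _ ≤ _ := by linarith

end Carleson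

section LocalFiniteness

variable {β : ℝ} {f : Rn n → ℝ} {E : Set (Rn n)} {L R γ : ℝ}

/-- The part of `areaDensity` at heights at most `R`. -/
def lowDensity (β : ℝ) (f : Rn n → ℝ) (R : ℝ) : Rn n × ℝ → ENNReal :=
  {p : Rn n × ℝ | p.2 ≤ R}.indicator (areaDensity β f)

lemma measurable_lowDensity (hβ : 0 < β) (hβ1 : β ≤ 1) (hf : LocallyIntegrable f) (R : ℝ) :
    Measurable (lowDensity β f R) :=
  (measurable_areaDensity hβ hβ1 hf).indicator (measurableSet_le measurable_snd measurable_const)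

/-- The Whitney box of the upper half space above a grid point. -/
def gridBox (R : ℝ) (i : ℕ × (Fin n → ℤ)) : Set (Rn n × ℝ) :=
  ball (gridPoint R i) ((n + 1) * gridScale R i.1) ×ˢ Ioc (gridScale R i.1 / 2) (gridScale R i.1)

lemma measurableSet_gridBox (i : ℕ × (Fin n → ℤ)) : MeasurableSet (gridBox R i) :=
  measurableSet_ball.prod measurableSet_Ioc

lemma volume_gridBox (hR : 0 < R) (i : ℕ × (Fin n → ℤ)) :
    volume (gridBox R i) = ENNReal.ofReal (((n + 1) * gridScale R i.1) ^ n) *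
      volume (ball (0 : Rn n) 1) * ENNReal.ofReal (gridScale R i.1 / 2) := by
  have hs := gridScale_pos hR i.1
  rw [gridBox, Measure.volume_eq_prod, Measure.prod_prod,
    Measure.addHaar_ball_of_pos _ _ (by positivity), finrank_euclideanSpace, Fintype.card_fin,
    Real.volume_Ioc, sub_half]

lemma exists_mem_gridBox (hR : 0 < R) {p : Rn n × ℝ} (hp : 0 < p.2) (hpR : p.2 ≤ R) :
    ∃ i, p ∈ gridBox R i := by
  obtain ⟨k, hk1, hk2⟩ := exists_nat_pow_near ((one_le_div hp).2 hpR) (one_lt_two (α := ℝ))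
  obtain ⟨m, hm⟩ := exists_dist_gridPoint_lt hR k p.1
  refine ⟨(k, m), mem_ball.2 hm, ?_, ?_⟩
  · change R / 2 ^ k / 2 < p.2
    rw [div_lt_iff₀ hp, pow_succ] at hk2
    rw [div_div, div_lt_iff₀ (by positivity)]
    linarith
  · change p.2 ≤ R / 2 ^ k
    rw [le_div_iff₀ hp] at hk1
    rw [le_div_iff₀ (by positivity)]
    linarith

lemma areaDensity_le_of_mem_gridBox (hβ : 0 < β) (hβ1 : β ≤ 1) (hf : LocallyIntegrable f)
    (hR : 0 < R) {i : ℕ × (Fin n → ℤ)} {p : Rn n × ℝ} (hp : p ∈ gridBox R i) :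
    areaDensity β f p ≤ ENNReal.ofReal
      (((2 * (n + 2)) ^ n * (2 * (n + 2)) ^ β *
        Abeta β f (gridPoint R i) ((n + 2) * gridScale R i.1)) ^ 2 *
        (2 / gridScale R i.1) ^ (n + 1)) := by
  obtain ⟨hp1, hp2, hp3⟩ := hp
  have hs := gridScale_pos hR i.1
  set s := gridScale R i.1
  have hp0 : 0 < p.2 := by linarith
  rw [areaDensity_of_pos hp0]
  rw [mem_ball] at hp1
  have h1 := Abeta_le_mul_Abeta (t' := (n + 2) * s) hβ hβ1 hf hp0
    (show dist p.1 (gridPoint R i) + p.2 ≤ (n + 2) * s by linarith)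
  have h2 : (n + 2) * s / p.2 ≤ 2 * (n + 2) := by
    rw [div_le_iff₀ hp0]
    nlinarith [(Nat.cast_nonneg n : (0 : ℝ) ≤ n)]
  have h0 := Abeta_nonneg (β := β) (f := f) (gridPoint R i) ((n + 2) * s)
  have h0' := Abeta_nonneg (β := β) (f := f) p.1 p.2
  have h3 : Abeta β f p.1 p.2 ≤ (2 * (n + 2)) ^ n * (2 * (n + 2)) ^ β *
      Abeta β f (gridPoint R i) ((n + 2) * s) := by
    refine h1.trans ?_
    gcongr
  refine ENNReal.ofReal_le_ofReal ?_
  have h4 : 1 / p.2 ≤ 2 / s := by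
    rw [div_le_div_iff₀ hp0 hs]
    linarith
  calc Abeta β f p.1 p.2 ^ 2 / p.2 ^ (n + 1) = Abeta β f p.1 p.2 ^ 2 * (1 / p.2) ^ (n + 1) := by
        rw [div_pow, one_pow, mul_one_div]
    _ ≤ _ := by gcongr

/-- The truncated area integral is integrable over sets where the maximal function is bounded. -/
lemma setLIntegral_coneSq_lowDensity_ne_top (hβ : 0 < β) (hβ1 : β ≤ 1) (hf : Integrable f)
    (hL : 0 ≤ L)
    (hE : ∀ x ∈ E, ∀ r : ℝ, 0 < r → ∫⁻ z in closedBall x r, ‖f z‖ₑ ≤ ENNReal.ofReal (L * r ^ n))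
    (hR : 0 < R) (hγ : 0 < γ) :
    ∫⁻ x in E, coneSq (lowDensity β f R) γ x ≠ ⊤ := by
  have hfl := hf.locallyIntegrable
  rw [setLIntegral_coneSq (measurable_lowDensity hβ hβ1 hfl R)]
  set A : ℝ := n + 2
  set B : ℝ := γ + (n + 1)
  set H : ℝ := (2 * A) ^ n * (2 * A) ^ β
  have hA : 1 ≤ A := by
    have : (0 : ℝ) ≤ n := Nat.cast_nonneg n
    simp only [A]
    linarith
  set v := volume (ball (0 : Rn n) 1)
  have hv : v ≠ ⊤ := measure_ball_lt_top.ne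
  obtain ⟨C, hC0, hC⟩ := exists_sum_Abeta_sq_le (R := R) (A := A) (B := B) hβ hβ1 hf hL hE hR hA
    (by positivity)
  let Q : Set (ℕ × (Fin n → ℤ)) := {i | ∃ x ∈ E, dist x (gridPoint R i) ≤ B * gridScale R i.1}
  let D : ℕ × (Fin n → ℤ) → ENNReal := fun i => ENNReal.ofReal
    ((H * Abeta β f (gridPoint R i) (A * gridScale R i.1)) ^ 2 * (2 / gridScale R i.1) ^ (n + 1)) *
    (ENNReal.ofReal ((γ * gridScale R i.1) ^ n) * v)
  have hpt : ∀ p : Rn n × ℝ, lowDensity β f R p * volume (E ∩ ball p.1 (γ * p.2)) ≤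
      ∑' i : Q, (gridBox R i.1).indicator (fun _ => D i.1) p := by
    intro p
    by_cases hp : 0 < p.2 ∧ p.2 ≤ R ∧ (E ∩ ball p.1 (γ * p.2)).Nonempty
    · obtain ⟨hp0, hpR, x, hxE, hx⟩ := hp
      obtain ⟨i, hi⟩ := exists_mem_gridBox hR hp0 hpR
      have hs := gridScale_pos hR i.1
      have hps : p.2 ≤ gridScale R i.1 := hi.2.2
      have hiQ : i ∈ Q := by
        refine ⟨x, hxE, ?_⟩
        have h1 : dist p.1 (gridPoint R i) < (n + 1) * gridScale R i.1 := hi.1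
        have h2 := dist_triangle x p.1 (gridPoint R i)
        have h3 : γ * p.2 ≤ γ * gridScale R i.1 := by gcongr
        rw [mem_ball] at hx
        simp only [B]
        linarith
      refine le_trans ?_ (ENNReal.le_tsum (⟨i, hiQ⟩ : Q))
      rw [indicator_of_mem hi]
      simp only [lowDensity, D]
      rw [indicator_of_mem (by exact hpR)]
      refine mul_le_mul' (areaDensity_le_of_mem_gridBox hβ hβ1 hfl hR hi) ?_
      refine (measure_mono inter_subset_right).trans ?_
      rw [Measure.addHaar_ball_of_pos _ _ (by positivity), finrank_euclideanSpace, Fintype.card_fin]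
      gcongr
    · have : lowDensity β f R p * volume (E ∩ ball p.1 (γ * p.2)) = 0 := by
        by_cases hp0 : 0 < p.2
        · by_cases hpR : p.2 ≤ R
          · have hem : ¬ (E ∩ ball p.1 (γ * p.2)).Nonempty := fun h => hp ⟨hp0, hpR, h⟩
            rw [not_nonempty_iff_eq_empty.1 hem, measure_empty, mul_zero]
          · rw [lowDensity, indicator_of_notMem (by exact hpR), zero_mul]
        · have := areaDensity_of_not_pos (β := β) (f := f) hp0
          by_cases hpR : p.2 ≤ R
          · rw [lowDensity, indicator_of_mem (by exact hpR), this, zero_mul]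
          · rw [lowDensity, indicator_of_notMem (by exact hpR), zero_mul]
      rw [this]
      exact zero_le
  have hbox : ∀ i, D i * volume (gridBox R i) = ENNReal.ofReal (H ^ 2 * 2 ^ n * γ ^ n * (n + 1) ^ n *
      (gridScale R i.1 ^ n * Abeta β f (gridPoint R i) (A * gridScale R i.1) ^ 2)) * v ^ 2 := by
    intro i
    have hs := gridScale_pos hR i.1
    simp only [D]
    rw [volume_gridBox hR]
    set a := Abeta β f (gridPoint R i) (A * gridScale R i.1)
    set s := gridScale R i.1
    calc _ = ENNReal.ofReal ((H * a) ^ 2 * (2 / s) ^ (n + 1)) * ENNReal.ofReal ((γ * s) ^ n) *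
          ENNReal.ofReal (((n + 1) * s) ^ n) * ENNReal.ofReal (s / 2) * v ^ 2 := by ring
      _ = _ := by
        rw [← ENNReal.ofReal_mul (by positivity), ← ENNReal.ofReal_mul (by positivity),
          ← ENNReal.ofReal_mul (by positivity)]
        congr 2
        clear_value H a s
        rw [mul_pow H a, div_pow, mul_pow γ s, mul_pow _ s, pow_succ 2, pow_succ s]
        field_simp
  set c : ℝ := H ^ 2 * 2 ^ n * γ ^ n * (n + 1) ^ n
  refine ne_top_of_le_ne_top (b := ENNReal.ofReal (c * C) * v ^ 2)
    (ENNReal.mul_ne_top ENNReal.ofReal_ne_top (ENNReal.pow_ne_top hv)) ?_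
  calc _ ≤ ∫⁻ p, ∑' i : Q, (gridBox R i.1).indicator (fun _ => D i.1) p := lintegral_mono hpt
    _ = ∑' i : Q, D i.1 * volume (gridBox R i.1) := by
        rw [lintegral_tsum fun i : Q =>
          (measurable_const.indicator (measurableSet_gridBox i.1)).aemeasurable]
        refine tsum_congr fun i => ?_
        rw [lintegral_indicator (measurableSet_gridBox _), setLIntegral_const]
    _ ≤ _ := by
        rw [ENNReal.tsum_eq_iSup_sum]
        refine iSup_le fun S => ?_
        simp only [hbox]
        rw [← Finset.sum_mul, ← ENNReal.ofReal_sum_of_nonneg, ← Finset.mul_sum]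
        · gcongr
          have h1 := hC (S.map (Function.Embedding.subtype _)) fun i hi => by
            obtain ⟨i', _, rfl⟩ := Finset.mem_map.1 hi
            exact i'.2
          rwa [Finset.sum_map] at h1
        · intro i _
          have := gridScale_pos hR i.1.1
          positivity

end LocalFiniteness

section AlmostEverywhere

variable {β : ℝ} {f : Rn n → ℝ} {R γ : ℝ}

/-- An integrable function has a finite maximal function almost everywhere. -/
lemma ae_exists_lintegral_closedBall_le (hf : Integrable f) :
    ∀ᵐ x : Rn n, ∃ m : ℕ, ∀ r : ℝ, 0 < r →
      ∫⁻ z in closedBall x r, ‖f z‖ₑ ≤ ENNReal.ofReal (m * r ^ n) := by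
  have hfin : ∫⁻ z, ‖f z‖ₑ ≠ ⊤ := hf.2.ne
  filter_upwards [(Besicovitch.vitaliFamily (volume : Measure (Rn n))).ae_tendsto_lintegral_div
    hf.1.enorm hfin] with x hx
  have h1 := hx.comp (Besicovitch.tendsto_filterAt (volume : Measure (Rn n)) x)
  have hv : volume (ball (0 : Rn n) 1) ≠ ⊤ := measure_ball_lt_top.ne
  have hlt : ‖f x‖ₑ < ‖f x‖ₑ + 1 := ENNReal.lt_add_right (by finiteness) one_ne_zero
  obtain ⟨δ, hδ, hsub⟩ := mem_nhdsGT_iff_exists_Ioo_subset.1 (h1.eventually_lt_const hlt)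
  have hδ : 0 < δ := hδ
  set I := ∫⁻ z, ‖f z‖ₑ
  obtain ⟨m, hm⟩ := exists_nat_ge (max (((‖f x‖ₑ + 1) * volume (ball (0 : Rn n) 1)).toReal)
    (I.toReal / (δ / 2) ^ n))
  refine ⟨m, fun r hr => ?_⟩
  rcases lt_or_ge r δ with hrδ | hrδ
  · have h2 : (∫⁻ z in closedBall x r, ‖f z‖ₑ) / volume (closedBall x r) < ‖f x‖ₑ + 1 :=
      hsub ⟨hr, hrδ⟩
    have h3 := (ENNReal.div_le_iff (measure_closedBall_pos volume x hr).ne'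
      measure_closedBall_lt_top.ne).1 h2.le
    refine h3.trans ?_
    rw [Measure.addHaar_closedBall _ _ hr.le, finrank_euclideanSpace, Fintype.card_fin,
      ENNReal.ofReal_mul (by positivity), mul_comm (ENNReal.ofReal (r ^ n)), ← mul_assoc]
    gcongr
    rw [← ENNReal.ofReal_toReal (by finiteness : (‖f x‖ₑ + 1) * volume (ball (0 : Rn n) 1) ≠ ⊤)]
    exact ENNReal.ofReal_le_ofReal ((le_max_left _ _).trans hm)
  · refine (setLIntegral_le_lintegral _ _).trans ?_
    change I ≤ _
    rw [← ENNReal.ofReal_toReal hfin]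
    refine ENNReal.ofReal_le_ofReal ?_
    have h2 := (div_le_iff₀ (by positivity)).1 ((le_max_right _ _).trans hm)
    refine h2.trans ?_
    gcongr
    linarith

lemma ae_coneSq_lowDensity_lt_top_of_integrable (hβ : 0 < β) (hβ1 : β ≤ 1) (hf : Integrable f)
    (hR : 0 < R) (hγ : 0 < γ) : ∀ᵐ x : Rn n, coneSq (lowDensity β f R) γ x < ⊤ := by
  have hm := measurable_coneSq (measurable_lowDensity hβ hβ1 hf.locallyIntegrable R) γ
  have h : ∀ m : ℕ, ∀ᵐ x : Rn n, x ∈ {x | ∀ r : ℝ, 0 < r →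
      ∫⁻ z in closedBall x r, ‖f z‖ₑ ≤ ENNReal.ofReal (m * r ^ n)} →
        coneSq (lowDensity β f R) γ x < ⊤ := fun m =>
    ae_imp_of_ae_restrict (ae_lt_top hm (setLIntegral_coneSq_lowDensity_ne_top hβ hβ1 hf
      m.cast_nonneg (fun x hx => hx) hR hγ))
  filter_upwards [ae_all_iff.2 h, ae_exists_lintegral_closedBall_le hf] with x hx ⟨m, hm⟩
  exact hx m hm

lemma coneSq_lowDensity_congr (hβ : 0 < β) (hβ1 : β ≤ 1) {g : Rn n → ℝ} {x : Rn n}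
    (hγ : 0 < γ) (h : ∀ z ∈ ball x ((γ + 1) * R), f z = g z) :
    coneSq (lowDensity β f R) γ x = coneSq (lowDensity β g R) γ x := by
  refine lintegral_congr fun p => ?_
  by_cases hp : dist x p.1 < γ * p.2
  · rw [indicator_of_mem (by exact hp), indicator_of_mem (by exact hp)]
    by_cases hpR : p.2 ≤ R
    · rw [lowDensity, lowDensity, indicator_of_mem (by exact hpR), indicator_of_mem (by exact hpR)]
      have hp0 : 0 < p.2 := by
        by_contra! hle
        nlinarith [dist_nonneg (x := x) (y := p.1)]
      rw [areaDensity_of_pos hp0, areaDensity_of_pos hp0,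
        Abeta_congr hβ hβ1 hp0 fun z hz => h z ?_]
      rw [mem_closedBall] at hz
      rw [mem_ball]
      have h1 := dist_triangle z p.1 x
      rw [dist_comm p.1 x] at h1
      have h2 : (γ + 1) * p.2 ≤ (γ + 1) * R := by gcongr
      linarith
    · rw [lowDensity, lowDensity, indicator_of_notMem (by exact hpR),
        indicator_of_notMem (by exact hpR)]
  · rw [indicator_of_notMem (by exact hp), indicator_of_notMem (by exact hp)]

lemma ae_coneSq_lowDensity_lt_top (hβ : 0 < β) (hβ1 : β ≤ 1) (hf : LocallyIntegrable f)
    (hR : 0 < R) (hγ : 0 < γ) : ∀ᵐ x : Rn n, coneSq (lowDensity β f R) γ x < ⊤ := by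
  have h : ∀ N : ℕ, ∀ᵐ x : Rn n,
      coneSq (lowDensity β ((closedBall 0 (N + (γ + 1) * R)).indicator f) R) γ x < ⊤ := fun N =>
    ae_coneSq_lowDensity_lt_top_of_integrable hβ hβ1 ((integrable_indicator_iff
      measurableSet_closedBall).2 (hf.integrableOn_isCompact (isCompact_closedBall _ _))) hR hγ
  filter_upwards [ae_all_iff.2 h] with x hx
  obtain ⟨N, hN⟩ := exists_nat_ge ‖x‖
  rw [coneSq_lowDensity_congr hβ hβ1 hγ fun z hz => ?_]
  · exact hx N
  · rw [indicator_of_mem]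
    rw [mem_closedBall]
    rw [mem_ball] at hz
    have := dist_triangle z x 0
    rw [dist_zero_right x] at this
    linarith

/-- Doubling the height controls the part of the cone integral far from the boundary. -/
lemma areaDensity_le_mul_areaDensity (hβ : 0 < β) (hβ1 : β ≤ 1) (hf : LocallyIntegrable f)
    (y : Rn n) (t : ℝ) :
    areaDensity β f (y, t) ≤
      ENNReal.ofReal ((2 ^ n * 2 ^ β) ^ 2 * 2 ^ (n + 1)) * areaDensity β f (y, 2 * t) := by
  by_cases ht : 0 < t
  · rw [areaDensity_of_pos (by exact ht), areaDensity_of_pos (by simpa using ht),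
      ← ENNReal.ofReal_mul (by positivity)]
    refine ENNReal.ofReal_le_ofReal ?_
    have h := Abeta_le_mul_Abeta (y := y) (y' := y) (t' := 2 * t) hβ hβ1 hf ht
      (by rw [dist_self]; linarith)
    rw [mul_div_cancel_right₀ _ ht.ne'] at h
    simp only
    calc Abeta β f y t ^ 2 / t ^ (n + 1)
        ≤ (2 ^ n * 2 ^ β * Abeta β f y (2 * t)) ^ 2 / t ^ (n + 1) := by
          have := Abeta_nonneg (β := β) (f := f) y t
          gcongr
      _ = _ := by
          rw [mul_pow 2 t, mul_pow (2 ^ n * 2 ^ β)]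
          field_simp
  · rw [areaDensity_of_not_pos (by exact ht)]
    exact zero_le

lemma lintegral_prod_comp_two_mul {G : Rn n × ℝ → ENNReal} (hG : Measurable G) :
    ∫⁻ p : Rn n × ℝ, G (p.1, 2 * p.2) = 2⁻¹ * ∫⁻ p : Rn n × ℝ, G p := by
  rw [Measure.volume_eq_prod, lintegral_prod _ (by fun_prop), lintegral_prod _ hG.aemeasurable,
    ← lintegral_const_mul _ hG.lintegral_prod_right']
  refine lintegral_congr fun y => ?_
  have h := lintegral_map (μ := volume) (f := fun t : ℝ => G (y, t)) (g := fun t : ℝ => 2 * t)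
    (hG.comp measurable_prodMk_left) (by fun_prop)
  rw [Real.map_volume_mul_left two_ne_zero, lintegral_smul_measure,
    abs_of_pos (by norm_num), ENNReal.ofReal_inv_of_pos two_pos, ENNReal.ofReal_ofNat] at h
  exact h.symm

lemma coneSq_areaDensity_le (hβ : 0 < β) (hβ1 : β ≤ 1) (hf : LocallyIntegrable f)
    (hγ : 1 ≤ γ) {x x₀ : Rn n} (hx : dist x x₀ ≤ R) :
    coneSq (areaDensity β f) γ x ≤ coneSq (lowDensity β f R) γ x +
      ENNReal.ofReal ((2 ^ n * 2 ^ β) ^ 2 * 2 ^ (n + 1)) *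
        (2⁻¹ * coneSq (areaDensity β f) γ x₀) := by
  have hG := measurable_areaDensity hβ hβ1 hf
  set K := ENNReal.ofReal ((2 ^ n * 2 ^ β) ^ 2 * 2 ^ (n + 1))
  have hset : MeasurableSet {p : Rn n × ℝ | dist x₀ p.1 < γ * p.2} :=
    (isOpen_lt (by fun_prop) (by fun_prop)).measurableSet
  have hcone := hG.indicator hset
  rw [coneSq, coneSq, coneSq, ← lintegral_prod_comp_two_mul hcone,
    ← lintegral_const_mul _ (by fun_prop), ← lintegral_add_right _ (by fun_prop)]
  refine lintegral_mono fun p => ?_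
  obtain ⟨y, t⟩ := p
  by_cases hp : dist x y < γ * t
  · rw [indicator_of_mem (by exact hp), indicator_of_mem (by exact hp)]
    by_cases hpR : t ≤ R
    · rw [lowDensity, indicator_of_mem (by exact hpR)]
      exact le_self_add
    · have h1 : dist x₀ y < γ * (2 * t) := by
        have := dist_triangle_left x₀ y x
        nlinarith [dist_nonneg (x := x) (y := x₀)]
      rw [indicator_of_mem (by exact h1)]
      exact (areaDensity_le_mul_areaDensity hβ hβ1 hf y t).trans le_add_self
  · rw [indicator_of_notMem (by exact hp)]
    exact zero_le

/-- The area integral is finite almost everywhere as soon as it is finite somewhere. -/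
lemma ae_coneSq_areaDensity_lt_top (hβ : 0 < β) (hβ1 : β ≤ 1) (hf : LocallyIntegrable f)
    (hγ : 1 ≤ γ) {x₀ : Rn n} (hx₀ : coneSq (areaDensity β f) γ x₀ < ⊤) :
    ∀ᵐ x : Rn n, coneSq (areaDensity β f) γ x < ⊤ := by
  have h : ∀ N : ℕ, ∀ᵐ x : Rn n, coneSq (lowDensity β f (N + 1 : ℝ)) γ x < ⊤ := fun N =>
    ae_coneSq_lowDensity_lt_top hβ hβ1 hf (by positivity) (by linarith)
  filter_upwards [ae_all_iff.2 h] with x hx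
  obtain ⟨N, hN⟩ := exists_nat_ge (dist x x₀)
  have hN' : dist x x₀ ≤ N + 1 := by linarith
  refine (coneSq_areaDensity_le hβ hβ1 hf hγ hN').trans_lt ?_
  exact ENNReal.add_lt_top.2 ⟨hx N, by finiteness⟩

end AlmostEverywhere

section Weighted

variable {β Cw q γ : ℝ} {f w : Rn n → ℝ}

lemma SbetaA_eq (hβ : 0 < β) (hβ1 : β ≤ 1) (hf : LocallyIntegrable f) (γ : ℝ) (x : Rn n) :
    SbetaA β γ f x = (coneSq (areaDensity β f) γ x).toReal ^ (1 / 2 : ℝ) := by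
  have hcone : MeasurableSet {p : Rn n × ℝ | dist x p.1 < γ * p.2} :=
    (isOpen_lt (by fun_prop) (by fun_prop)).measurableSet
  have hS : MeasurableSet {p : Rn n × ℝ | dist x p.1 < γ * p.2 ∧ 0 < p.2} :=
    hcone.inter measurableSet_upperHalf
  rw [SbetaA]
  congr 1
  calc _ = ∫ p in {p : Rn n × ℝ | dist x p.1 < γ * p.2 ∧ 0 < p.2}, (areaDensity β f p).toReal := by
        refine setIntegral_congr_fun hS fun p hp => ?_
        have hp0 : 0 < p.2 := hp.2
        rw [areaDensity_of_pos hp0, ENNReal.toReal_ofReal (by positivity)]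
    _ = (∫⁻ p in {p : Rn n × ℝ | dist x p.1 < γ * p.2 ∧ 0 < p.2}, areaDensity β f p).toReal := by
        refine integral_toReal (measurable_areaDensity hβ hβ1 hf).aemeasurable
          ((ae_restrict_iff' hS).2 (Filter.Eventually.of_forall fun p hp => ?_))
        rw [areaDensity_of_pos hp.2]
        exact ENNReal.ofReal_lt_top
    _ = _ := by
        rw [← lintegral_indicator hS]
        congr 1
        refine lintegral_congr fun p => ?_
        by_cases hp : 0 < p.2
        · simp only [indicator_apply, mem_ofPred_eq, hp, and_true]
        · simp only [indicator_apply, areaDensity_of_not_pos hp, ite_self]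

/-- The measure with density `w`. -/
def weightMeasure (w : Rn n → ℝ) : Measure (Rn n) := volume.withDensity fun x => ENNReal.ofReal (w x)

instance : SFinite (weightMeasure w) := by
  unfold weightMeasure
  infer_instance

lemma weightMeasure_ball (hw0 : ∀ x, 0 ≤ w x) (hw : LocallyIntegrable w) (y : Rn n) (r : ℝ) :
    weightMeasure w (ball y r) = ENNReal.ofReal (∫ x in ball y r, w x) := by
  rw [weightMeasure, withDensity_apply _ measurableSet_ball, ofReal_integral_eq_lintegral_ofReal]
  · exact (hw.integrableOn_isCompact (isCompact_closedBall y r)).mono_set ball_subset_closedBall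
  · exact Filter.Eventually.of_forall hw0

lemma isLocallyFiniteMeasure_weightMeasure (hw0 : ∀ x, 0 ≤ w x) (hw : LocallyIntegrable w) :
    IsLocallyFiniteMeasure (weightMeasure w) :=
  ⟨fun x => ⟨ball x 1, ball_mem_nhds x one_pos, by
    rw [weightMeasure_ball hw0 hw]
    exact ENNReal.ofReal_lt_top⟩⟩

/-- An `A₁` weight is doubling, with the optimal exponent. -/
lemma IsA1.weightMeasure_ball_le (hw : IsA1 w Cw) (y : Rn n) (r ρ : ℝ) (hr : 0 < r) (hρ : 1 ≤ ρ) :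
    weightMeasure w (ball y (ρ * r)) ≤
      ENNReal.ofReal (max Cw 1) * ENNReal.ofReal ρ ^ n * weightMeasure w (ball y r) := by
  obtain ⟨hw0, hwl, hA⟩ := hw
  have hρ0 : 0 < ρ := by linarith
  rw [weightMeasure_ball hw0 hwl, weightMeasure_ball hw0 hwl, ← ENNReal.ofReal_pow hρ0.le,
    ← ENNReal.ofReal_mul (by positivity), ← ENNReal.ofReal_mul (by positivity)]
  refine ENNReal.ofReal_le_ofReal ((hA y (ρ * r) (by positivity)).trans ?_)
  set m := essInf w (volume.restrict (ball y (ρ * r))) with hm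
  have hm0 : 0 ≤ m := by
    rw [hm, essInf_eq_sSup]
    refine Real.sSup_nonneg' ⟨0, ?_, le_rfl⟩
    simp [not_lt.2 (hw0 _)]
  have hae : ∀ᵐ x ∂volume.restrict (ball y (ρ * r)), m ≤ w x :=
    ae_essInf_le ⟨0, Filter.eventually_map.2 (Filter.Eventually.of_forall hw0)⟩
  have hsub : ball y r ⊆ ball y (ρ * r) := ball_subset_ball (by nlinarith)
  have hsmall : (volume (ball y r)).toReal * m ≤ ∫ x in ball y r, w x := by
    calc (volume (ball y r)).toReal * m = ∫ _ in ball y r, m := by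
          rw [setIntegral_const, smul_eq_mul, Measure.real]
      _ ≤ _ := by
          refine integral_mono_ae (integrableOn_const measure_ball_lt_top.ne)
            ((hwl.integrableOn_isCompact (isCompact_closedBall y r)).mono_set ball_subset_closedBall)
            (ae_restrict_of_ae_restrict_of_subset hsub hae)
  have hvol : (volume (ball y (ρ * r))).toReal = ρ ^ n * (volume (ball y r)).toReal := by
    rw [Measure.addHaar_ball_mul_of_pos _ _ hρ0, finrank_euclideanSpace, Fintype.card_fin,
      Measure.addHaar_ball_center volume y, ENNReal.toReal_mul, ENNReal.toReal_ofReal (by positivity)]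
  calc Cw * (volume (ball y (ρ * r))).toReal * m
      ≤ max Cw 1 * (volume (ball y (ρ * r))).toReal * m := by
        gcongr
        exact le_max_left _ _
    _ = max Cw 1 * ρ ^ n * ((volume (ball y r)).toReal * m) := by rw [hvol]; ring
    _ ≤ _ := by gcongr

lemma wLq_eq (hw0 : ∀ x, 0 ≤ w x) (hw : LocallyIntegrable w) {g : Rn n → ℝ} (hg : Measurable g)
    (hg0 : ∀ x, 0 ≤ g x) :
    wLq q w g = (∫⁻ x, ENNReal.ofReal (g x ^ q) ∂weightMeasure w).toReal ^ (1 / q) := by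
  have hwm : AEStronglyMeasurable w := hw.aestronglyMeasurable
  rw [wLq, weightMeasure, lintegral_withDensity_eq_lintegral_mul₀ (by fun_prop) (by fun_prop),
    integral_eq_lintegral_of_nonneg_ae]
  · congr 2
    refine lintegral_congr fun x => ?_
    rw [Pi.mul_apply, ← ENNReal.ofReal_mul (hw0 x), abs_of_nonneg (hg0 x), mul_comm]
  · exact Filter.Eventually.of_forall fun x =>
      mul_nonneg (Real.rpow_nonneg (abs_nonneg _) _) (hw0 x)
  · exact AEStronglyMeasurable.mul (hg.abs.pow_const q).aestronglyMeasurable hwm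

/-- The aperture comparison for a general aperture `ρ ≥ 1`. -/
lemma wLq_SbetaA_le (hβ : 0 < β) (hβ1 : β ≤ 1) (hq1 : 1 < q) (hq2 : q < 2) (hw : IsA1 w Cw)
    (hf : LocallyIntegrable f) {ρ : ℝ} (hρ : 1 ≤ ρ) :
    wLq q w (SbetaA β ρ f) ≤
      (2 * max Cw 1 ^ 2 * 4 ^ n * (1 + q / (2 - q))) ^ (1 / q) * (ρ ^ n) ^ (1 / q) *
        wLq q w (SbetaA β 1 f) := by
  have hG := measurable_areaDensity hβ hβ1 hf
  have hμ := isLocallyFiniteMeasure_weightMeasure hw.1 hw.2.1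
  have hq0 : 0 < q := by linarith
  have hq2' : 0 < 2 - q := by linarith
  have hρ0 : 0 < ρ := by linarith
  have hS : ∀ γ, SbetaA β γ f = fun x => (coneSq (areaDensity β f) γ x).toReal ^ (1 / 2 : ℝ) :=
    fun γ => funext (SbetaA_eq hβ hβ1 hf γ)
  have hmeas : ∀ γ, Measurable fun x => (coneSq (areaDensity β f) γ x).toReal ^ (1 / 2 : ℝ) :=
    fun γ => (measurable_coneSq hG γ).ennreal_toReal.pow_const _
  have hpos : ∀ γ x, 0 ≤ (coneSq (areaDensity β f) γ x).toReal ^ (1 / 2 : ℝ) :=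
    fun γ x => by positivity
  set I : ℝ → ENNReal := fun γ => ∫⁻ x, ENNReal.ofReal
    (((coneSq (areaDensity β f) γ x).toReal ^ (1 / 2 : ℝ)) ^ q) ∂weightMeasure w with hI
  have hL : ∀ γ, wLq q w (SbetaA β γ f) = (I γ).toReal ^ (1 / q) := fun γ => by
    rw [hS, wLq_eq hw.1 hw.2.1 (hmeas γ) (hpos γ)]
  rw [hL, hL]
  have hRHS : 0 ≤ (2 * max Cw 1 ^ 2 * 4 ^ n * (1 + q / (2 - q))) ^ (1 / q) * (ρ ^ n) ^ (1 / q) *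
      (I 1).toReal ^ (1 / q) := by positivity
  have hzero : (0 : ℝ) ^ (1 / q) = 0 := Real.zero_rpow (by positivity)
  by_cases hex : ∃ x₀, coneSq (areaDensity β f) ρ x₀ < ⊤
  swap
  · push Not at hex
    have : I ρ = 0 := by
      simp only [hI, top_le_iff.1 (hex _), ENNReal.toReal_top]
      rw [Real.zero_rpow (by norm_num), Real.zero_rpow hq0.ne']
      simp
    rwa [this, ENNReal.toReal_zero, hzero]
  obtain ⟨x₀, hx₀⟩ := hex
  have hfin : ∀ᵐ x ∂weightMeasure w, coneSq (areaDensity β f) ρ x < ⊤ :=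
    (withDensity_absolutelyContinuous _ _).ae_le (ae_coneSq_areaDensity_lt_top hβ hβ1 hf hρ hx₀)
  have hmono := coneSq_mono (G := areaDensity β f) hρ fun p hp => areaDensity_of_not_pos hp
  rcases eq_or_ne (I ρ) ⊤ with htop | htop
  · rwa [htop, ENNReal.toReal_top, hzero]
  have hI1 : I 1 ≤ I ρ := by
    refine lintegral_mono_ae ?_
    filter_upwards [hfin] with x hx
    have := ENNReal.toReal_mono hx.ne (hmono x)
    gcongr
  have hI1top : I 1 ≠ ⊤ := ne_top_of_le_ne_top htop hI1
  have hmain : I ρ ≤ _ := lintegral_coneSq_rpow_le (μ := weightMeasure w)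
    (C₀ := ENNReal.ofReal (max Cw 1)) (by simp) ENNReal.ofReal_ne_top
    hw.weightMeasure_ball_le hG hq0 hq2 hρ
    (hfin.mono fun x hx => (hmono x).trans_lt hx)
  have hmain' := ENNReal.toReal_mono (by finiteness) hmain
  rw [← Real.mul_rpow (by positivity) (by positivity), ← Real.mul_rpow (by positivity) (by positivity)]
  refine Real.rpow_le_rpow ENNReal.toReal_nonneg (hmain'.trans (le_of_eq ?_)) (by positivity)
  have h1 : (1 + ENNReal.ofReal (q / (2 - q))).toReal = 1 + q / (2 - q) := by
    rw [ENNReal.toReal_add (by simp) (by simp), ENNReal.toReal_ofReal (by positivity),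
      ENNReal.toReal_one]
  have h2 : (ENNReal.ofReal (max Cw 1)).toReal = max Cw 1 := ENNReal.toReal_ofReal (by positivity)
  simp only [ENNReal.toReal_mul, ENNReal.toReal_pow, h1, h2, ENNReal.toReal_ofReal hρ0.le,
    ENNReal.toReal_ofNat]
  ring

end Weighted

/-- aperture comparison in `L^q_w`, `1 < q < 2`:
`‖S_{β,2^j}(f)‖_{L^q_w} ≤ C 2^{jn/q} ‖S_β(f)‖_{L^q_w}`. -/
theorem stmt9 (β Cw q : ℝ) (hβ : 0 < β) (hβ1 : β ≤ 1) (hq1 : 1 < q) (hq2 : q < 2)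
    (w : Rn n → ℝ) (hw : IsA1 w Cw) :
    ∃ C > 0, ∀ (j : ℕ) (f : Rn n → ℝ), MeasureTheory.LocallyIntegrable f →
      wLq q w (SbetaA β ((2 : ℝ) ^ j) f) ≤
        C * (2 : ℝ) ^ ((j : ℝ) * (n : ℝ) / q) * wLq q w (SbetaA β 1 f) := by
  have hq2' : 0 < 2 - q := by linarith
  refine ⟨(2 * max Cw 1 ^ 2 * 4 ^ n * (1 + q / (2 - q))) ^ (1 / q), by positivity,
    fun j f hf => ?_⟩
  refine (wLq_SbetaA_le hβ hβ1 hq1 hq2 hw hf (one_le_pow₀ one_le_two)).trans (le_of_eq ?_)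
  rw [← pow_mul, ← Real.rpow_natCast 2 (j * n), ← Real.rpow_mul two_pos.le, Nat.cast_mul, mul_one_div]
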